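/- arXiv:1510.07661 — 2 statements merged into one kernel-verified Lean document; each statement's English description precedes it below -/
import Mathlib

section
/- Let d ≥ 2 be an integer, q a prime power with q ≡ 1 (mod d), set t = (q−1)/d, let T be a generator of the group of multiplicative characters of F_q^×, ε the trivial character, and λ ∈ F_q^×. Let W = {w = (w₁,…,w_d) : 0 ≤ wᵢ < d and Σᵢ wᵢ ≡ 0 (mod d)}, and W** = {w ∈ W : every wᵢ ≠ 0 and the wᵢ are not all equal}. Then the number of points in P^{d−1}(F_q) on the Dwork hypersurface x₁^d + ⋯ + x_d^d = dλ·x₁⋯x_d equals (q^{d−1}−1)/(q−1) + q^{d−2} · ₍d−1₎F₍d−2₎(T^t, T^{2t}, …, T^{(d−1)t}; ε, …, ε | 1/λ^d)_q + (1/q)·Σ_{w∈W**} Πᵢ g(T^{wᵢt}) + (1/(q−1))·Σ_{[w]} Σ_{j=0}^{q−2} (Πᵢ g(T^{wᵢt+j}) / g(T^{dj}))·T^{dj}(dλ), where the last outer sum runs over one representative w of each equivalence class of W under w ~ w + c·(1,…,1) (mod d), excluding the class of (0,…,0). -/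
/-- The standard additive character of a finite field `F` of characteristic `p`,
built from a primitive `p`-th root of unity `ζ` in `ℂ`:  `θ x = ζ ^ tr(x)`. -/
noncomputable def stdAddChar {F : Type*} [Field F] [Fintype F] (p : ℕ) [CharP F p]
    [Algebra (ZMod p) F] (ζ : ℂ) (x : F) : ℂ :=
  ζ ^ (Algebra.trace (ZMod p) F x).val

/-- The Gauss sum `g(χ) = ∑ₓ χ(x) θ(x)` with respect to the standard additive character. -/
noncomputable def gaussSum' {F : Type*} [Field F] [Fintype F] (p : ℕ) [CharP F p]
    [Algebra (ZMod p) F] (ζ : ℂ) (χ : MulChar F ℂ) : ℂ :=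
  ∑ x : F, χ x * stdAddChar p ζ x

/-- Greene's normalized Jacobi sum `binom(A,B) = B(-1)/q · ∑ₓ A(x) B̄(1-x)`. -/
noncomputable def jacB {F : Type*} [Field F] [Fintype F] (A B : MulChar F ℂ) : ℂ :=
  B (-1) / (Fintype.card F : ℂ) * ∑ x : F, A x * B⁻¹ (1 - x)

/-- Greene's finite field hypergeometric function `₂F₁(A, B; C | x)`. -/
noncomputable def greene2F1 {F : Type*} [Field F] [Fintype F]
    (A B C : MulChar F ℂ) (x : F) : ℂ :=
  (Fintype.card F : ℂ) / ((Fintype.card F : ℂ) - 1) *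
    ∑ᶠ χ : MulChar F ℂ, jacB (A * χ) χ * jacB (B * χ) (C * χ) * χ x

/-- Greene's finite field hypergeometric function `₃F₂(A₀, A₁, A₂; B₁, B₂ | x)`. -/
noncomputable def greene3F2 {F : Type*} [Field F] [Fintype F]
    (A₀ A₁ A₂ B₁ B₂ : MulChar F ℂ) (x : F) : ℂ :=
  (Fintype.card F : ℂ) / ((Fintype.card F : ℂ) - 1) *
    ∑ᶠ χ : MulChar F ℂ,
      jacB (A₀ * χ) χ * jacB (A₁ * χ) (B₁ * χ) * jacB (A₂ * χ) (B₂ * χ) * χ x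

/-- Greene's finite field hypergeometric function `ₙ₊₁Fₙ(A₀,…,Aₙ; B₁,…,Bₙ | x)`. -/
noncomputable def greeneF {F : Type*} [Field F] [Fintype F] (n : ℕ)
    (A : Fin (n + 1) → MulChar F ℂ) (B : Fin n → MulChar F ℂ) (x : F) : ℂ :=
  (Fintype.card F : ℂ) / ((Fintype.card F : ℂ) - 1) *
    ∑ᶠ χ : MulChar F ℂ,
      (jacB (A 0 * χ) χ * ∏ i : Fin n, jacB (A i.succ * χ) (B i * χ)) * χ x

/-- The number of points of the Dwork hypersurface
`x₁^d + ⋯ + x_d^d = dλ·x₁⋯x_d` in `ℙ^{d-1}(F)`. -/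
noncomputable def dworkHypersurfaceCount (F : Type*) [Field F] [Fintype F]
    (d : ℕ) (lam : F) : ℕ :=
  Nat.card {P : Projectivization F (Fin d → F) //
    ∑ i, P.rep i ^ d = (d : F) * lam * ∏ i, P.rep i}

namespace Polynomial

section PowerSum

variable {F : Type*} [Field F]

/-- The logarithmic derivative `-X R' / R` of the reversed polynomial `R`, which is the generating
series of the power sums of the roots. -/
noncomputable def powerSumSeries (f : F[X]) : PowerSeries F :=
  -(PowerSeries.X * PowerSeries.derivative F (f.reverse : PowerSeries F)) *
    (f.reverse : PowerSeries F)⁻¹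

/-- The sum of the `m`-th powers of the roots of `f`, as an element of the base field. -/
noncomputable def powerSum (m : ℕ) (f : F[X]) : F :=
  PowerSeries.coeff m f.powerSumSeries

lemma Monic.constantCoeff_reverse {f : F[X]} (hf : f.Monic) :
    PowerSeries.constantCoeff (f.reverse : PowerSeries F) = 1 := by
  rw [← PowerSeries.coeff_zero_eq_constantCoeff_apply, Polynomial.coeff_coe,
    coeff_zero_reverse, hf.leadingCoeff]

lemma Monic.powerSumSeries_mul_reverse {f : F[X]} (hf : f.Monic) :
    f.powerSumSeries * (f.reverse : PowerSeries F) =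
      -(PowerSeries.X * PowerSeries.derivative F (f.reverse : PowerSeries F)) := by
  rw [powerSumSeries, mul_assoc, PowerSeries.inv_mul_cancel _ (by simp [hf.constantCoeff_reverse]),
    mul_one]

lemma Monic.reverse_coe_ne_zero {f : F[X]} (hf : f.Monic) : (f.reverse : PowerSeries F) ≠ 0 := by
  intro h
  simpa [h] using hf.constantCoeff_reverse

lemma Monic.eq_powerSumSeries {f : F[X]} (hf : f.Monic) {S : PowerSeries F}
    (h : S * (f.reverse : PowerSeries F) =
      -(PowerSeries.X * PowerSeries.derivative F (f.reverse : PowerSeries F))) :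
    S = f.powerSumSeries :=
  mul_right_cancel₀ hf.reverse_coe_ne_zero (h.trans hf.powerSumSeries_mul_reverse.symm)

lemma Monic.powerSumSeries_mul {f g : F[X]} (hf : f.Monic) (hg : g.Monic) :
    (f * g).powerSumSeries = f.powerSumSeries + g.powerSumSeries := by
  symm
  apply (hf.mul hg).eq_powerSumSeries
  rw [reverse_mul_of_domain, Polynomial.coe_mul, Derivation.leibniz]
  simp only [smul_eq_mul]
  linear_combination (g.reverse : PowerSeries F) * hf.powerSumSeries_mul_reverse +
    (f.reverse : PowerSeries F) * hg.powerSumSeries_mul_reverse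

lemma Monic.powerSum_mul {f g : F[X]} (hf : f.Monic) (hg : g.Monic) (m : ℕ) :
    powerSum m (f * g) = powerSum m f + powerSum m g := by
  simp [powerSum, hf.powerSumSeries_mul hg]

lemma powerSum_one (m : ℕ) : powerSum m (1 : F[X]) = 0 := by
  have h := monic_one.powerSum_mul (monic_one (R := F)) m
  rw [one_mul] at h
  linear_combination -h

lemma Monic.powerSum_map {K : Type*} [Field K] (φ : F →+* K) {f : F[X]} (hf : f.Monic) (m : ℕ) :
    powerSum m (f.map φ) = φ (powerSum m f) := by
  have hr : (f.map φ).reverse = f.reverse.map φ := by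
    rw [reverse, reverse, hf.natDegree_map, reflect_map]
  have hS : PowerSeries.map φ f.powerSumSeries = (f.map φ).powerSumSeries := by
    apply (hf.map φ).eq_powerSumSeries
    have h := congrArg (PowerSeries.map φ) hf.powerSumSeries_mul_reverse
    rw [hr, PowerSeries.derivative_coe, derivative_map, Polynomial.polynomial_map_coe,
      Polynomial.polynomial_map_coe, ← map_mul, h, PowerSeries.derivative_coe, map_neg, map_mul,
      PowerSeries.map_X]
  rw [powerSum, ← hS, PowerSeries.coeff_map, powerSum]

lemma powerSum_X_sub_C (a : F) {m : ℕ} (hm : m ≠ 0) : powerSum m (X - C a) = a ^ m := by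
  have hr : (X - C a).reverse = 1 - C a * X := by
    rw [reverse, natDegree_X_sub_C, reflect_sub]
    simp [reflect_C]
  have hS : PowerSeries.mk (fun n ↦ if n = 0 then 0 else a ^ n) = (X - C a).powerSumSeries := by
    apply (monic_X_sub_C a).eq_powerSumSeries
    rw [hr, PowerSeries.derivative_coe]
    ext n
    rcases n with _ | _ | n <;>
    simp [mul_sub, ← mul_assoc, PowerSeries.coeff_succ_mul_X, pow_succ, PowerSeries.coeff_X]
  rw [powerSum, ← hS]
  simp [hm]

lemma Splits.powerSum_eq {f : F[X]} (hf : f.Monic) (hs : f.Splits) {m : ℕ} (hm : m ≠ 0) :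
    powerSum m f = (f.roots.map (· ^ m)).sum := by
  have key : ∀ s : Multiset F,
      powerSum m (s.map (fun a ↦ X - C a)).prod = (s.map (· ^ m)).sum := by
    intro s
    induction s using Multiset.induction_on with
    | empty => simp [powerSum_one]
    | cons a s ih =>
      rw [Multiset.map_cons, Multiset.prod_cons,
        (monic_X_sub_C a).powerSum_mul (monic_multiset_prod_of_monic _ _ fun b _ ↦ monic_X_sub_C b),
        ih, powerSum_X_sub_C a hm]
      simp
  rw [← key, ← hs.eq_prod_roots_of_monic hf]

lemma Monic.powerSum_add_C_mul_X_pow {f : F[X]} (hf : f.Monic) {m : ℕ} (hm : m ≠ 0)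
    (hmn : m ≤ f.natDegree) (c : F) :
    powerSum m (f + C c * X ^ (f.natDegree - m)) = powerSum m f - m * c := by
  have hdeg : (C c * X ^ (f.natDegree - m)).degree < f.degree := by
    refine (degree_C_mul_X_pow_le _ _).trans_lt ?_
    rw [degree_eq_natDegree hf.ne_zero]
    exact_mod_cast (by omega)
  have hmon : (f + C c * X ^ (f.natDegree - m)).Monic := hf.add_of_left hdeg
  have hnat : (f + C c * X ^ (f.natDegree - m)).natDegree = f.natDegree :=
    natDegree_add_eq_left_of_degree_lt hdeg
  have hr : (f + C c * X ^ (f.natDegree - m)).reverse = f.reverse + C c * X ^ m := by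
    rw [reverse, hnat, reflect_add, reflect_C_mul_X_pow, revAt_le (by omega), reverse]
    congr 3
    omega
  obtain ⟨m, rfl⟩ := Nat.exists_eq_succ_of_ne_zero hm
  set S := f.powerSumSeries
  set g := f + C c * X ^ (f.natDegree - (m + 1))
  have hS : g.powerSumSeries =
      S + -(PowerSeries.X ^ (m + 1) * (PowerSeries.C c * (((m + 1 : ℕ) : PowerSeries F) + S) *
        (g.reverse : PowerSeries F)⁻¹)) := by
    symm
    apply hmon.eq_powerSumSeries
    have h1 := hf.powerSumSeries_mul_reverse
    have h2 : (g.reverse : PowerSeries F)⁻¹ * (g.reverse : PowerSeries F) = 1 :=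
      PowerSeries.inv_mul_cancel _ (by simp [hmon.constantCoeff_reverse])
    have h3 : (g.reverse : PowerSeries F) =
        (f.reverse : PowerSeries F) + PowerSeries.C c * PowerSeries.X ^ (m + 1) := by
      rw [hr]; simp
    have h4 : PowerSeries.derivative F (g.reverse : PowerSeries F) =
        PowerSeries.derivative F (f.reverse : PowerSeries F) +
          PowerSeries.C c * (((m + 1 : ℕ) : PowerSeries F) * PowerSeries.X ^ m) := by
      rw [h3, map_add, Derivation.leibniz, PowerSeries.derivative_C, PowerSeries.derivative_pow]
      simp
    rw [h4, add_mul, neg_mul]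
    have h5 : PowerSeries.X ^ (m + 1) * (PowerSeries.C c * (((m + 1 : ℕ) : PowerSeries F) + S) *
        (g.reverse : PowerSeries F)⁻¹) * (g.reverse : PowerSeries F) =
        PowerSeries.X ^ (m + 1) * (PowerSeries.C c * (((m + 1 : ℕ) : PowerSeries F) + S)) := by
      linear_combination (PowerSeries.X ^ (m + 1) *
        (PowerSeries.C c * (((m + 1 : ℕ) : PowerSeries F) + S))) * h2
    rw [h5, h3]
    linear_combination h1
  have hS0 : PowerSeries.constantCoeff S = 0 := by
    simp [S, powerSumSeries]
  rw [powerSum, hS, map_add, map_neg, PowerSeries.coeff_X_pow_mul', if_pos le_rfl, Nat.sub_self,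
    PowerSeries.coeff_zero_eq_constantCoeff_apply]
  simp [hS0, hmon.constantCoeff_reverse, powerSum, S]
  ring

end PowerSum

end Polynomial

namespace Polynomial

/-- The product of the roots of a monic polynomial, as an element of the base ring. -/
noncomputable def rootProd {F : Type*} [CommRing F] (f : F[X]) : F :=
  (-1) ^ f.natDegree * f.coeff 0

lemma rootProd_mul {F : Type*} [Field F] {f g : F[X]} (hf : f.Monic) (hg : g.Monic) :
    rootProd (f * g) = rootProd f * rootProd g := by
  rw [rootProd, hf.natDegree_mul hg, mul_coeff_zero, rootProd, rootProd]
  ring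

lemma rootProd_pow {F : Type*} [Field F] {f : F[X]} (hf : f.Monic) (k : ℕ) :
    rootProd (f ^ k) = rootProd f ^ k := by
  induction k with
  | zero => simp [rootProd]
  | succ k ih => rw [pow_succ, rootProd_mul (hf.pow k) hf, ih, pow_succ]

lemma powerSum_pow {F : Type*} [Field F] {f : F[X]} (hf : f.Monic) (m k : ℕ) :
    powerSum m (f ^ k) = k * powerSum m f := by
  induction k with
  | zero => simp [powerSum_one]
  | succ k ih => rw [pow_succ, (hf.pow k).powerSum_mul hf, ih]; push_cast; ring

end Polynomial

open Polynomial in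
/-- The characteristic polynomial of an element of a finite extension. -/
noncomputable def elemCharpoly (F : Type*) {L : Type*} [Field F] [Field L] [Algebra F L] (x : L) :
    F[X] :=
  minpoly F x ^ Module.finrank (IntermediateField.adjoin F {x}) L

namespace elemCharpoly

open Polynomial IntermediateField

variable {F L : Type*} [Field F] [Field L] [Algebra F L] [FiniteDimensional F L]

lemma monic (x : L) : (elemCharpoly F x).Monic :=
  (minpoly.monic (Algebra.IsIntegral.isIntegral x)).pow _

lemma natDegree_minpoly_mul (x : L) :
    (minpoly F x).natDegree * Module.finrank (IntermediateField.adjoin F {x}) L =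
      Module.finrank F L := by
  rw [← adjoin.finrank (Algebra.IsIntegral.isIntegral x), Module.finrank_mul_finrank]

lemma natDegree_eq (x : L) : (elemCharpoly F x).natDegree = Module.finrank F L := by
  rw [elemCharpoly, natDegree_pow, mul_comm, natDegree_minpoly_mul]

lemma rootProd_eq (x : L) : rootProd (elemCharpoly F x) = Algebra.norm F x := by
  have hx : IsIntegral F x := Algebra.IsIntegral.isIntegral x
  rw [elemCharpoly, rootProd_pow (minpoly.monic hx), Algebra.norm_eq_norm_adjoin F x,
    ← adjoin.powerBasis_gen hx, Algebra.PowerBasis.norm_gen_eq_coeff_zero_minpoly,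
    adjoin.powerBasis_gen hx, minpoly_gen, rootProd, adjoin.powerBasis_dim]

lemma powerSum_eq [Algebra.IsSeparable F L] (x : L) {m : ℕ} (hm : m ≠ 0) :
    powerSum m (elemCharpoly F x) = Algebra.trace F L (x ^ m) := by
  have hx : IsIntegral F x := Algebra.IsIntegral.isIntegral x
  have hmon := minpoly.monic hx
  let K := AlgebraicClosure F
  have hsep : Algebra.IsSeparable F F⟮x⟯ := Algebra.isSeparable_tower_bot_of_isSeparable F F⟮x⟯ L
  have htr : powerSum m (minpoly F x) = Algebra.trace F F⟮x⟯ (AdjoinSimple.gen F x ^ m) := by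
    apply (algebraMap F K).injective
    rw [← hmon.powerSum_map, Splits.powerSum_eq (hmon.map _) (IsAlgClosed.splits _) hm,
      trace_eq_sum_embeddings K]
    classical
    set pb := adjoin.powerBasis hx
    have hgen : AdjoinSimple.gen F x = pb.gen := (adjoin.powerBasis_gen hx).symm
    have hmin : minpoly F x = minpoly F pb.gen := by rw [← hgen, minpoly_gen]
    have hnd : ((minpoly F pb.gen).aroots K).Nodup :=
      nodup_roots ((separable_map _).mpr (Algebra.IsSeparable.isSeparable F _))
    rw [Fintype.sum_equiv pb.liftEquiv' (fun σ : F⟮x⟯ →ₐ[F] K ↦ σ (AdjoinSimple.gen F x ^ m))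
      (fun y ↦ (y : K) ^ m) (fun σ ↦ by rw [map_pow, PowerBasis.liftEquiv'_apply_coe, hgen]), hmin]
    rw [Finset.sum_mem_multiset _ _ (fun y ↦ y ^ m) (fun _ ↦ rfl), Finset.sum_eq_multiset_sum,
      Multiset.toFinset_val, Multiset.dedup_eq_self.mpr hnd]
  rw [elemCharpoly, powerSum_pow hmon, htr]
  conv_rhs =>
    rw [← AdjoinSimple.algebraMap_gen F x, ← map_pow, ← Algebra.trace_trace (S := F⟮x⟯),
      Algebra.trace_algebraMap, LinearMap.map_smul_of_tower, nsmul_eq_mul]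

end elemCharpoly

namespace FiniteField

open Polynomial

variable (F : Type*) [Field F] [Finite F] (p : ℕ) [Fact p.Prime] [CharP F p]

open Classical in
lemma card_filter_minpoly_eq (k : ℕ) [NeZero k] [Fintype (Extension F p k)] {P : F[X]}
    (hP : Irreducible P) (hm : P.Monic) :
    (Finset.univ.filter fun x : Extension F p k ↦ minpoly F x = P).card =
      if P.natDegree ∣ k then P.natDegree else 0 := by
  split_ifs with h
  · have hdvd : P ∣ X ^ Nat.card F ^ k - X := hP.natDegree_dvd_iff_dvd_X_pow_card_pow_sub_X.mp h
    have hs : (P.map (algebraMap F (Extension F p k))).Splits := by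
      refine Splits.of_dvd ?_ ?_ (map_dvd (algebraMap F (Extension F p k)) hdvd)
      · apply IsSplittingField.splits
      · exact map_ne_zero (FiniteField.X_pow_card_pow_sub_X_ne_zero _ (NeZero.ne k)
          Finite.one_lt_card)
    rw [← card_rootSet_eq_natDegree (PerfectField.separable_of_irreducible hP) hs,
      ← Set.toFinset_card]
    congr 1
    ext x
    simp only [Finset.mem_filter, Finset.mem_univ, true_and, Set.mem_toFinset, mem_rootSet]
    constructor
    · rintro rfl
      exact ⟨hm.ne_zero, minpoly.aeval _ _⟩
    · rintro ⟨-, hx⟩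
      exact (minpoly.eq_of_irreducible_of_monic hP hx hm).symm
  · rw [Finset.card_eq_zero, Finset.filter_eq_empty_iff]
    rintro x - rfl
    refine h ?_
    conv_rhs => rw [← finrank_extension F p k]
    exact Dvd.intro _ (elemCharpoly.natDegree_minpoly_mul x)


open Classical in
/-- Every monic polynomial of degree `n` is divisible by the characteristic polynomials of exactly
`n` elements of the extensions of degree at most `n`. -/
lemma sum_card_elemCharpoly_dvd [∀ k : ℕ, Fintype (Extension F p (k + 1))] {f : F[X]}
    (hf : f.Monic) :
    ∑ k ∈ Finset.range f.natDegree,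
      (Finset.univ.filter fun x : Extension F p (k + 1) ↦ elemCharpoly F x ∣ f).card =
        f.natDegree := by
  set s := UniqueFactorizationMonoid.normalizedFactors f
  have hs : ∀ P ∈ s, Irreducible P ∧ P.Monic := fun P hP ↦
    ⟨UniqueFactorizationMonoid.irreducible_of_normalized_factor P hP,
      (normalize_eq_self_iff_monic (UniqueFactorizationMonoid.irreducible_of_normalized_factor P
        hP).ne_zero).mp (UniqueFactorizationMonoid.normalize_normalized_factor P hP)⟩
  have hprod : s.prod = f := by
    rw [UniqueFactorizationMonoid.prod_normalizedFactors_eq hf.ne_zero, hf.normalize_eq_self]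
  have hdeg : ∑ P ∈ s.toFinset, s.count P * P.natDegree = f.natDegree := by
    conv_rhs => rw [← hprod, natDegree_multiset_prod_of_monic _ fun P hP ↦ (hs P hP).2]
    rw [Finset.sum_multiset_map_count]
    simp
  have hdvd : ∀ P ∈ s, ∀ m, P ^ m ∣ f ↔ m ≤ s.count P := by
    intro P hP m
    rw [UniqueFactorizationMonoid.dvd_iff_normalizedFactors_le_normalizedFactors
      (pow_ne_zero _ (hs P hP).1.ne_zero) hf.ne_zero,
      UniqueFactorizationMonoid.normalizedFactors_pow,
      UniqueFactorizationMonoid.normalizedFactors_irreducible (hs P hP).1,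
      (hs P hP).2.normalize_eq_self, Multiset.nsmul_singleton, Multiset.le_count_iff_replicate_le]
  have hfin : ∀ (k : ℕ) (x : Extension F p (k + 1)),
      Module.finrank (IntermediateField.adjoin F {x}) (Extension F p (k + 1)) =
        (k + 1) / (minpoly F x).natDegree := by
    intro k x
    have h := elemCharpoly.natDegree_minpoly_mul (F := F) x
    rw [finrank_extension F p (k + 1)] at h
    exact (Nat.div_eq_of_eq_mul_right (minpoly.natDegree_pos (Algebra.IsIntegral.isIntegral x))
      h.symm).symm
  have hcard : ∀ k : ℕ,
      (Finset.univ.filter fun x : Extension F p (k + 1) ↦ elemCharpoly F x ∣ f).card =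
        ∑ P ∈ s.toFinset, if P.natDegree ∣ k + 1 ∧ (k + 1) / P.natDegree ≤ s.count P
          then P.natDegree else 0 := by
    intro k
    rw [Finset.card_eq_sum_card_fiberwise (f := fun x ↦ minpoly F x) (t := s.toFinset)]
    · refine Finset.sum_congr rfl fun P hP ↦ ?_
      rw [Multiset.mem_toFinset] at hP
      have := card_filter_minpoly_eq F p (k + 1) (hs P hP).1 (hs P hP).2
      rw [Finset.filter_filter]
      by_cases hc : (k + 1) / P.natDegree ≤ s.count P
      · simp only [hc, and_true]
        rw [← this]
        congr 1
        refine Finset.filter_congr fun x _ ↦ ?_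
        refine and_iff_right_of_imp fun hx ↦ ?_
        rw [elemCharpoly, hfin, hx, hdvd P hP]
        exact hc
      · simp only [hc, and_false, if_false]
        rw [Finset.card_eq_zero, Finset.filter_eq_empty_iff]
        rintro x - ⟨hx, rfl⟩
        rw [elemCharpoly, hfin, hdvd _ hP] at hx
        exact hc hx
    · intro x hx
      simp only [Finset.coe_filter, Finset.mem_univ, true_and, Set.mem_ofPred_eq] at hx
      have hint : IsIntegral F x := Algebra.IsIntegral.isIntegral x
      simp only [Finset.mem_coe, Multiset.mem_toFinset]
      rw [UniqueFactorizationMonoid.mem_normalizedFactors_iff' hf.ne_zero]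
      refine ⟨minpoly.irreducible hint, (minpoly.monic hint).normalize_eq_self, ?_⟩
      exact (dvd_pow_self _ Module.finrank_pos.ne').trans hx
  simp_rw [hcard]
  rw [Finset.sum_comm, ← hdeg]
  refine Finset.sum_congr rfl fun P hP ↦ ?_
  have hle : s.count P * P.natDegree ≤ f.natDegree := by
    rw [← hdeg]
    exact Finset.single_le_sum (f := fun P ↦ s.count P * P.natDegree) (fun _ _ ↦ Nat.zero_le _) hP
  rw [Multiset.mem_toFinset] at hP
  have hpos : 0 < P.natDegree := (hs P hP).1.natDegree_pos
  rw [← Finset.sum_filter, Finset.sum_const, smul_eq_mul, hdeg]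
  congr 1
  conv_rhs => rw [← Finset.card_range (s.count P)]
  symm
  refine Finset.card_bij (fun i _ ↦ P.natDegree * (i + 1) - 1) ?_ ?_ ?_
  · intro i hi
    rw [Finset.mem_range] at hi
    have h1 : 0 < P.natDegree * (i + 1) := by positivity
    have h2 : P.natDegree * (i + 1) ≤ s.count P * P.natDegree := by
      rw [mul_comm]; exact Nat.mul_le_mul_right _ hi
    rw [Finset.mem_filter, Finset.mem_range, Nat.sub_add_cancel h1, Nat.mul_div_cancel_left _ hpos]
    exact ⟨by omega, Dvd.intro _ rfl, hi⟩
  · intro i _ j _ hij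
    have h1 : 0 < P.natDegree * (i + 1) := by positivity
    have h2 : 0 < P.natDegree * (j + 1) := by positivity
    have h3 : P.natDegree * (i + 1) = P.natDegree * (j + 1) := by
      have hij' : P.natDegree * (i + 1) - 1 = P.natDegree * (j + 1) - 1 := hij
      omega
    have := Nat.eq_of_mul_eq_mul_left hpos h3
    omega
  · intro k hk
    rw [Finset.mem_filter, Finset.mem_range] at hk
    obtain ⟨hk, ⟨m, hm⟩, hle⟩ := hk
    rw [hm, Nat.mul_div_cancel_left _ hpos] at hle
    have : m ≠ 0 := by rintro rfl; simp at hm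
    refine ⟨m - 1, by rw [Finset.mem_range]; omega, ?_⟩
    rw [Nat.sub_add_cancel (by omega), ← hm, Nat.add_sub_cancel]

end FiniteField

section RootCount

variable {G : Type*} [CommGroup G] [Fintype G] [IsCyclic G]

open Classical in
/-- Detecting `d`-th powers in a finite cyclic group by a character of order `d`. -/
lemma IsCyclic.card_filter_pow_eq {R : Type*} [Field R] (ρ : G →* Rˣ) (y : G) :
    ((Finset.univ.filter fun x : G ↦ x ^ orderOf ρ = y).card : R) =
      ∑ a ∈ Finset.range (orderOf ρ), (ρ y : R) ^ a := by
  set d := orderOf ρ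
  obtain ⟨γ, hγ⟩ := IsCyclic.exists_monoid_generator (α := G)
  have hρ : ∀ z : G, ρ z ^ d = 1 := fun z ↦ by
    rw [← MonoidHom.pow_apply, pow_orderOf_eq_one, MonoidHom.one_apply]
  have hdN : d ∣ Nat.card G := by
    refine orderOf_dvd_of_pow_eq_one (MonoidHom.ext fun z ↦ ?_)
    rw [MonoidHom.pow_apply, ← map_pow, pow_card_eq_one', map_one, MonoidHom.one_apply]
  by_cases hy : ρ y = 1
  · obtain ⟨z, rfl⟩ : ∃ z, z ^ d = y := by
      obtain ⟨j, rfl⟩ := hγ y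
      simp only at hy
      have h1 : orderOf ρ ∣ j := by
        refine orderOf_dvd_of_pow_eq_one (MonoidHom.ext fun w ↦ ?_)
        obtain ⟨i, rfl⟩ := hγ w
        simp only [map_pow] at hy
        rw [MonoidHom.pow_apply, map_pow, pow_right_comm, hy, one_pow, MonoidHom.one_apply]
      obtain ⟨k, rfl⟩ := h1
      exact ⟨γ ^ k, by rw [← pow_mul, mul_comm]⟩
    have hcard := MonoidHom.card_fiber_eq_of_mem_range (powMonoidHom d : G →* G)
      (x := z ^ d) (y := 1) ⟨z, rfl⟩ ⟨1, by simp⟩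
    have hker := IsCyclic.card_powMonoidHom_ker G d
    rw [Nat.gcd_eq_right hdN] at hker
    simp only [powMonoidHom_apply] at hcard
    rw [hcard, hy]
    simp only [Units.val_one, one_pow, Finset.sum_const, Finset.card_range, nsmul_eq_mul, mul_one]
    rw [← Fintype.card_subtype, ← Nat.card_eq_fintype_card]
    exact congrArg _ hker
  · have h0 : (Finset.univ.filter fun x : G ↦ x ^ d = y) = ∅ := by
      rw [Finset.filter_eq_empty_iff]
      rintro x - rfl
      exact hy (by rw [map_pow, hρ])
    have h := mul_geom_sum (ρ y : R) d
    rw [← Units.val_pow_eq_pow_val, hρ, Units.val_one, sub_self] at h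
    rw [h0, (mul_eq_zero.mp h).resolve_left fun h ↦ hy (Units.ext (sub_eq_zero.mp h))]
    simp

/-- Summing a function of `x ^ d` over a finite cyclic group. -/
lemma IsCyclic.sum_comp_pow {R : Type*} [Field R] (ρ : G →* Rˣ) (f : G → R) :
    ∑ x : G, f (x ^ orderOf ρ) =
      ∑ a ∈ Finset.range (orderOf ρ), ∑ y : G, (ρ y : R) ^ a * f y := by
  classical
  rw [Finset.sum_comm, ← Finset.sum_fiberwise Finset.univ (fun x : G ↦ x ^ orderOf ρ)]
  refine Finset.sum_congr rfl fun y _ ↦ ?_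
  rw [← Finset.sum_mul, ← IsCyclic.card_filter_pow_eq, ← nsmul_eq_mul, ← Finset.sum_const]
  refine Finset.sum_congr ?_ fun x hx ↦ by rw [(Finset.mem_filter.mp hx).2]
  congr

end RootCount

lemma sum_units_eq {E R : Type*} [Field E] [Fintype E] [AddCommMonoid R] [Fintype Eˣ]
    (f : E → R) (hf : f 0 = 0) :
    ∑ u : Eˣ, f u = ∑ x : E, f x := by
  classical
  rw [Fintype.sum_eq_sum_compl_add (0 : E) f, hf, add_zero]
  refine Finset.sum_bij (fun u _ ↦ (u : E)) (fun u _ ↦ by simp) (fun u _ v _ h ↦ Units.ext h)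
    (fun x hx ↦ ⟨Units.mk0 x (by simpa using hx), by simp, rfl⟩) (fun _ _ ↦ rfl)

section LFunction

open Polynomial

variable {F : Type*} [Field F] (χ : MulChar F ℂ) (ψ : AddChar F ℂ) (m : ℕ)

/-- The completely multiplicative weight `χ (∏ α) * ψ (∑ α ^ m)` of a monic polynomial with
roots `α`. -/
noncomputable def charWeight (f : F[X]) : ℂ := χ (rootProd f) * ψ (powerSum m f)

lemma charWeight_mul {f g : F[X]} (hf : f.Monic) (hg : g.Monic) :
    charWeight χ ψ m (f * g) = charWeight χ ψ m f * charWeight χ ψ m g := by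
  rw [charWeight, rootProd_mul hf hg, hf.powerSum_mul hg, map_mul, AddChar.map_add_eq_mul]
  simp only [charWeight]
  ring

variable [Fintype F]

lemma finite_monicsOfDegree (n : ℕ) : {f : F[X] | f.Monic ∧ f.natDegree = n}.Finite := by
  refine Set.Finite.of_injOn (f := fun (f : F[X]) (i : Fin (n + 1)) ↦ f.coeff i)
    (Set.mapsTo_univ _ _) ?_ Set.finite_univ
  rintro f ⟨-, hf⟩ g ⟨-, hg⟩ h
  ext i
  by_cases hi : i < n + 1
  · exact congrFun h ⟨i, hi⟩
  · rw [coeff_eq_zero_of_natDegree_lt (by omega), coeff_eq_zero_of_natDegree_lt (by omega)]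

/-- The monic polynomials of degree `n` over a finite field. -/
noncomputable def monicsOfDegree (F : Type*) [Field F] [Fintype F] (n : ℕ) : Finset F[X] :=
  (finite_monicsOfDegree n).toFinset

lemma mem_monicsOfDegree {n : ℕ} {f : F[X]} :
    f ∈ monicsOfDegree F n ↔ f.Monic ∧ f.natDegree = n := by
  simp [monicsOfDegree]

/-- Translation by a monomial of lower degree permutes the monic polynomials of degree `n`. -/
lemma sum_monicsOfDegree_add {n i : ℕ} (hi : i < n) (c : F) (G : F[X] → ℂ) :
    ∑ f ∈ monicsOfDegree F n, G (f + C c * X ^ i) = ∑ f ∈ monicsOfDegree F n, G f := by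
  have key : ∀ (c : F), ∀ f ∈ monicsOfDegree F n, f + C c * X ^ i ∈ monicsOfDegree F n := by
    intro c f hf
    rw [mem_monicsOfDegree] at hf ⊢
    have hdeg : (C c * X ^ i).degree < f.degree := by
      refine (degree_C_mul_X_pow_le _ _).trans_lt ?_
      rw [degree_eq_natDegree hf.1.ne_zero, hf.2]
      exact_mod_cast hi
    exact ⟨hf.1.add_of_left hdeg, (natDegree_add_eq_left_of_degree_lt hdeg).trans hf.2⟩
  refine Finset.sum_bij' (fun f _ ↦ f + C c * X ^ i) (fun f _ ↦ f + C (-c) * X ^ i)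
    (key c) (key (-c)) ?_ ?_ fun _ _ ↦ rfl <;>
  · intro f _
    simp

/-- The `L`-function of `charWeight`. -/
noncomputable def charLSeries : PowerSeries ℂ :=
  PowerSeries.mk fun n ↦ ∑ f ∈ monicsOfDegree F n, charWeight χ ψ m f

variable (p : ℕ) [Fact p.Prime] [CharP F p] [∀ k : ℕ, Fintype (FiniteField.Extension F p (k + 1))]

/-- The logarithmic derivative of `charLSeries`, given by character sums over the extensions
of `F`. -/
noncomputable def charTraceSeries : PowerSeries ℂ :=
  PowerSeries.mk fun k ↦ ∑ x : FiniteField.Extension F p (k + 1),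
    charWeight χ ψ m (elemCharpoly F x)

lemma derivative_charLSeries :
    PowerSeries.derivative ℂ (charLSeries χ ψ m) =
      charTraceSeries χ ψ m p * charLSeries χ ψ m := by
  classical
  ext n
  rw [PowerSeries.coeff_derivative, PowerSeries.coeff_mul,
    Finset.Nat.sum_antidiagonal_eq_sum_range_succ
      (fun i j ↦ PowerSeries.coeff i (charTraceSeries χ ψ m p) *
        PowerSeries.coeff j (charLSeries χ ψ m))]
  simp only [charLSeries, charTraceSeries, PowerSeries.coeff_mk]
  have h1 : (∑ f ∈ monicsOfDegree F (n + 1), charWeight χ ψ m f) * ((n : ℂ) + 1) =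
      ∑ f ∈ monicsOfDegree F (n + 1), ∑ k ∈ Finset.range (n + 1),
        ∑ x : FiniteField.Extension F p (k + 1),
          if elemCharpoly F x ∣ f then charWeight χ ψ m f else 0 := by
    rw [Finset.sum_mul]
    refine Finset.sum_congr rfl fun f hf ↦ ?_
    rw [mem_monicsOfDegree] at hf
    have h := FiniteField.sum_card_elemCharpoly_dvd F p hf.1
    rw [hf.2] at h
    simp_rw [← Finset.sum_filter, Finset.sum_const]
    rw [← Finset.sum_smul, h, nsmul_eq_mul, mul_comm]
    push_cast
    rfl
  rw [h1, Finset.sum_comm]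
  refine Finset.sum_congr rfl fun k hk ↦ ?_
  rw [Finset.mem_range] at hk
  rw [Finset.sum_comm, Finset.sum_mul]
  refine Finset.sum_congr rfl fun x _ ↦ ?_
  have hx : (elemCharpoly F x).natDegree = k + 1 := by
    rw [elemCharpoly.natDegree_eq, FiniteField.finrank_extension]
  have hmon : (elemCharpoly F x).Monic := elemCharpoly.monic x
  rw [← Finset.sum_filter, Finset.mul_sum]
  symm
  refine Finset.sum_bij (fun g _ ↦ elemCharpoly F x * g) ?_ ?_ ?_ ?_
  · intro g hg
    rw [mem_monicsOfDegree] at hg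
    rw [Finset.mem_filter, mem_monicsOfDegree, hmon.natDegree_mul hg.1, hx, hg.2]
    exact ⟨⟨hmon.mul hg.1, by omega⟩, dvd_mul_right _ _⟩
  · intro g _ g' _ h
    exact mul_left_cancel₀ hmon.ne_zero h
  · intro f hf
    rw [Finset.mem_filter, mem_monicsOfDegree] at hf
    obtain ⟨⟨hf, hn⟩, g, rfl⟩ := hf
    have hg : g.Monic := hmon.of_mul_monic_left hf
    rw [hmon.natDegree_mul hg, hx] at hn
    exact ⟨g, mem_monicsOfDegree.mpr ⟨hg, by omega⟩, rfl⟩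
  · intro g hg
    rw [mem_monicsOfDegree] at hg
    rw [charWeight_mul χ ψ m hmon hg.1]

lemma monicsOfDegree_zero : monicsOfDegree F 0 = {1} := by
  ext f
  rw [mem_monicsOfDegree, Finset.mem_singleton]
  constructor
  · rintro ⟨h1, h2⟩
    exact h1.natDegree_eq_zero.mp h2
  · rintro rfl
    exact ⟨monic_one, natDegree_one⟩

lemma constantCoeff_charLSeries :
    PowerSeries.constantCoeff (charLSeries χ ψ m) = 1 := by
  rw [← PowerSeries.coeff_zero_eq_constantCoeff_apply, charLSeries, PowerSeries.coeff_mk,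
    monicsOfDegree_zero, Finset.sum_singleton, charWeight, powerSum_one]
  simp [rootProd]

lemma charLSeries_one (hψ : ψ ≠ 1) :
    charLSeries χ ψ 1 = ((1 + C (gaussSum χ ψ) * X : ℂ[X]) : PowerSeries ℂ) := by
  ext n
  rw [Polynomial.coeff_coe]
  rcases n with _ | _ | n
  · rw [PowerSeries.coeff_zero_eq_constantCoeff_apply, constantCoeff_charLSeries]
    simp
  · rw [charLSeries, PowerSeries.coeff_mk]
    simp only [zero_add, coeff_add, coeff_C_mul, coeff_X_one, mul_one]
    rw [coeff_one, if_neg one_ne_zero, zero_add, gaussSum]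
    symm
    refine Finset.sum_bij (fun a _ ↦ X - C a) ?_ ?_ ?_ ?_
    · intro a _
      exact mem_monicsOfDegree.mpr ⟨monic_X_sub_C a, natDegree_X_sub_C a⟩
    · intro a _ b _ h
      exact C_injective (sub_right_injective h)
    · intro f hf
      rw [mem_monicsOfDegree] at hf
      refine ⟨-f.coeff 0, Finset.mem_univ _, ?_⟩
      rw [hf.1.eq_X_add_C hf.2]
      simp
    · intro a _
      rw [charWeight, powerSum_X_sub_C a one_ne_zero, pow_one, rootProd, natDegree_X_sub_C]
      simp
  · obtain ⟨c, hc⟩ := AddChar.ne_one_iff.mp hψ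
    rw [charLSeries, PowerSeries.coeff_mk]
    have h := sum_monicsOfDegree_add (F := F) (n := n + 2) (i := n + 1) (by omega) c
      (charWeight χ ψ 1)
    have h2 : ∀ f ∈ monicsOfDegree F (n + 2),
        charWeight χ ψ 1 (f + C c * X ^ (n + 1)) = ψ (-c) * charWeight χ ψ 1 f := by
      intro f hf
      have hf' := hf
      rw [mem_monicsOfDegree] at hf
      have h3 := hf.1.powerSum_add_C_mul_X_pow one_ne_zero (by omega) c
      have h4 : f.natDegree - 1 = n + 1 := by omega
      rw [h4] at h3
      have hdeg : (C c * X ^ (n + 1)).degree < f.degree := by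
        refine (degree_C_mul_X_pow_le _ _).trans_lt ?_
        rw [degree_eq_natDegree hf.1.ne_zero, hf.2]
        exact_mod_cast (by omega)
      have h5 : rootProd (f + C c * X ^ (n + 1)) = rootProd f := by
        rw [rootProd, natDegree_add_eq_left_of_degree_lt hdeg, rootProd]
        simp
      rw [charWeight, h3, h5, Nat.cast_one, one_mul, sub_eq_add_neg, AddChar.map_add_eq_mul,
        charWeight]
      ring
    rw [Finset.sum_congr rfl h2, ← Finset.mul_sum] at h
    have h6 : ψ (-c) ≠ 1 := by
      rw [AddChar.map_neg_eq_inv]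
      simpa using hc
    have h7 : (ψ (-c) - 1) * ∑ f ∈ monicsOfDegree F (n + 2), charWeight χ ψ 1 f = 0 := by
      rw [sub_mul, h, one_mul, sub_self]
    rw [(mul_eq_zero.mp h7).resolve_left (sub_ne_zero.mpr h6)]
    simp [coeff_one]

end LFunction

section HasseDavenport

open Polynomial

variable {F : Type*} [Field F] (χ η : MulChar F ℂ) (ψ : AddChar F ℂ)

lemma sum_norm_trace_pow (E : Type*) [Field E] [Fintype E] [Algebra F E] (hη : orderOf η ≠ 0) :
    ∑ x : E, (χ ^ orderOf η) (Algebra.norm F x) * ψ (Algebra.trace F E (x ^ orderOf η)) =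
      ∑ a ∈ Finset.range (orderOf η), ∑ x : E,
        (χ * η ^ a) (Algebra.norm F x) * ψ (Algebra.trace F E x) := by
  classical
  obtain ⟨ρ, hρdef⟩ : ∃ ρ : Eˣ →* ℂˣ, ρ =
      MonoidHom.compHom' (Units.map (Algebra.norm F)) (MulChar.mulEquivToUnitHom η) := ⟨_, rfl⟩
  have hρ : orderOf ρ = orderOf η := by
    have hinj : Function.Injective
        (MonoidHom.compHom' (Units.map (Algebra.norm F (S := E))) : (Fˣ →* ℂˣ) →* (Eˣ →* ℂˣ)) := by
      intro f g hfg
      ext u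
      obtain ⟨v, rfl⟩ := FiniteField.unitsMap_norm_surjective F E u
      exact congrArg Units.val (DFunLike.congr_fun hfg v)
    rw [← orderOf_injective (MulChar.mulEquivToUnitHom (R := F) (R' := ℂ)).toMonoidHom
      (MulChar.mulEquivToUnitHom).injective η]
    rw [hρdef]
    exact orderOf_injective _ hinj _
  have hval : ∀ u : Eˣ, (ρ u : ℂ) = η (Algebra.norm F (u : E)) := fun u ↦ by
    rw [hρdef]
    exact MulChar.coe_equivToUnitHom η _
  have h := IsCyclic.sum_comp_pow ρ fun u : Eˣ ↦
    χ (Algebra.norm F (u : E)) * ψ (Algebra.trace F E (u : E))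
  rw [hρ] at h
  have hn0 : Algebra.norm F (0 : E) = 0 := Algebra.norm_zero
  rw [← sum_units_eq (E := E) _ (by rw [hn0, MulChar.map_zero, zero_mul])]
  simp only [Units.val_pow_eq_pow_val, map_pow] at h
  simp_rw [MulChar.pow_apply' _ hη]
  rw [h]
  refine Finset.sum_congr rfl fun a _ ↦ ?_
  rw [← sum_units_eq (E := E) _ (by rw [hn0, MulChar.map_zero, zero_mul])]
  refine Finset.sum_congr rfl fun u _ ↦ ?_
  rw [hval, MulChar.mul_apply]
  have hu : (Algebra.norm F (u : E)) = ((Units.map (Algebra.norm F) u : Fˣ) : F) := rfl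
  rw [hu, MulChar.pow_apply_coe]
  ring

variable [Fintype F]

lemma charTraceSeries_pow (p : ℕ) [Fact p.Prime] [CharP F p]
    [∀ k : ℕ, Fintype (FiniteField.Extension F p (k + 1))] (hη : orderOf η ≠ 0) :
    charTraceSeries (χ ^ orderOf η) ψ (orderOf η) p =
      ∑ a ∈ Finset.range (orderOf η), charTraceSeries (χ * η ^ a) ψ 1 p := by
  ext k
  rw [map_sum]
  simp only [charTraceSeries, PowerSeries.coeff_mk, charWeight, elemCharpoly.rootProd_eq,
    elemCharpoly.powerSum_eq _ hη, elemCharpoly.powerSum_eq _ one_ne_zero, pow_one]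
  exact sum_norm_trace_pow χ η ψ _ hη

lemma charLSeries_eq_prod (hη : orderOf η ≠ 0) :
    charLSeries (χ ^ orderOf η) ψ (orderOf η) =
      ∏ a ∈ Finset.range (orderOf η), charLSeries (χ * η ^ a) ψ 1 := by
  classical
  obtain ⟨p, hp⟩ := CharP.exists F
  have : Fact p.Prime := ⟨CharP.char_is_prime F p⟩
  have (k : ℕ) : Fintype (FiniteField.Extension F p (k + 1)) := Fintype.ofFinite _
  set L := charLSeries (χ ^ orderOf η) ψ (orderOf η)
  have hprod : ∀ s : Finset ℕ, PowerSeries.derivative ℂ (∏ a ∈ s, charLSeries (χ * η ^ a) ψ 1) =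
      (∑ a ∈ s, charTraceSeries (χ * η ^ a) ψ 1 p) * ∏ a ∈ s, charLSeries (χ * η ^ a) ψ 1 := by
    intro s
    induction s using Finset.induction_on with
    | empty => simp
    | insert a s ha ih =>
      rw [Finset.prod_insert ha, Finset.sum_insert ha, Derivation.leibniz, ih,
        derivative_charLSeries _ _ _ p]
      simp only [smul_eq_mul]
      ring
  set M := ∏ a ∈ Finset.range (orderOf η), charLSeries (χ * η ^ a) ψ 1
  have hM : PowerSeries.derivative ℂ M = charTraceSeries (χ ^ orderOf η) ψ (orderOf η) p * M := by
    rw [charTraceSeries_pow χ η ψ p hη]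
    exact hprod _
  have hL : PowerSeries.derivative ℂ L = charTraceSeries (χ ^ orderOf η) ψ (orderOf η) p * L :=
    derivative_charLSeries _ _ _ p
  have hM0 : PowerSeries.constantCoeff M = 1 := by
    rw [map_prod]
    exact Finset.prod_eq_one fun a _ ↦ constantCoeff_charLSeries _ _ _
  have hL0 : PowerSeries.constantCoeff L = 1 := constantCoeff_charLSeries _ _ _
  have hMinv : M * M⁻¹ = 1 := PowerSeries.mul_inv_cancel _ (by simp [hM0])
  have hone : L * M⁻¹ = 1 := by
    apply PowerSeries.derivative.ext
    · rw [Derivation.leibniz, PowerSeries.derivative_inv', hM, hL]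
      simp only [smul_eq_mul, Derivation.map_one_eq_zero]
      linear_combination (-L * M⁻¹ * charTraceSeries (χ ^ orderOf η) ψ (orderOf η) p) * hMinv
    · simp [hM0, hL0]
  calc L = L * M⁻¹ * M := by rw [mul_assoc, mul_comm _ M, hMinv, mul_one]
    _ = M := by rw [hone, one_mul]

lemma sum_charWeight_eq_prod (hψ : ψ ≠ 1) (hη : orderOf η ≠ 0) :
    ∑ f ∈ monicsOfDegree F (orderOf η), charWeight (χ ^ orderOf η) ψ (orderOf η) f =
      ∏ a ∈ Finset.range (orderOf η), gaussSum (χ * η ^ a) ψ := by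
  have h := congrArg (PowerSeries.coeff (orderOf η)) (charLSeries_eq_prod χ η ψ hη)
  simp_rw [charLSeries_one _ ψ hψ] at h
  rw [charLSeries, PowerSeries.coeff_mk] at h
  have h2 : ∏ a ∈ Finset.range (orderOf η),
      ((1 + C (gaussSum (χ * η ^ a) ψ) * X : ℂ[X]) : PowerSeries ℂ) =
        ((∏ a ∈ Finset.range (orderOf η), (1 + C (gaussSum (χ * η ^ a) ψ) * X) : ℂ[X]) :
          PowerSeries ℂ) := by
    simp only [← coeToPowerSeries.ringHom_apply, map_prod]
  have h3 := coeff_prod_of_natDegree_le (Finset.range (orderOf η))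
    (fun a ↦ 1 + C (gaussSum (χ * η ^ a) ψ) * X) 1 fun a _ ↦ by compute_degree
  rw [Finset.card_range, mul_one] at h3
  rw [h, h2, Polynomial.coeff_coe, h3]
  simp [coeff_one]

lemma card_mul_sum_charWeight (d : ℕ) (hd : (d : F) ≠ 0) :
    (Fintype.card F : ℂ) * ∑ f ∈ monicsOfDegree F d, charWeight (χ ^ d) ψ d f =
      (∑ f ∈ monicsOfDegree F d, ψ (powerSum d f + d * f.coeff 0)) *
        (χ⁻¹ d ^ d * gaussSum (χ ^ d) ψ) := by
  have hd0 : d ≠ 0 := by rintro rfl; simp at hd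
  have hodd : χ ((-1) ^ (d + 1)) ^ d = 1 := by
    rw [← map_pow, ← pow_mul, mul_comm, (Nat.even_mul_succ_self d).neg_one_pow, map_one]
  have h1 : ∀ c : F, ∑ f ∈ monicsOfDegree F d, charWeight (χ ^ d) ψ d f =
      ∑ f ∈ monicsOfDegree F d, charWeight (χ ^ d) ψ d (f + C c) := by
    intro c
    have := sum_monicsOfDegree_add (F := F) (i := 0) (Nat.pos_of_ne_zero hd0) c
      (charWeight (χ ^ d) ψ d)
    simpa using this.symm
  have h2 : (Fintype.card F : ℂ) * ∑ f ∈ monicsOfDegree F d, charWeight (χ ^ d) ψ d f =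
      ∑ c : F, ∑ f ∈ monicsOfDegree F d, charWeight (χ ^ d) ψ d (f + C c) := by
    rw [← Finset.sum_congr rfl fun c _ ↦ h1 c, Finset.sum_const, nsmul_eq_mul, Finset.card_univ]
  rw [h2, Finset.sum_comm, Finset.sum_mul]
  refine Finset.sum_congr rfl fun f hf ↦ ?_
  rw [mem_monicsOfDegree] at hf
  have h3 : ∀ c : F, charWeight (χ ^ d) ψ d (f + C c) =
      (χ ^ d) ((-1) ^ d * (f.coeff 0 + c)) * ψ (powerSum d f - d * c) := by
    intro c
    have h := hf.1.powerSum_add_C_mul_X_pow hd0 hf.2.ge c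
    rw [hf.2, Nat.sub_self, pow_zero, mul_one] at h
    rw [charWeight, h, rootProd]
    simp [hf.2]
  simp_rw [h3]
  rw [gaussSum, Finset.mul_sum, Finset.mul_sum]
  let e : F ≃ F := (Equiv.addLeft (f.coeff 0)).trans (Equiv.mulLeft₀ (-(d : F)) (neg_ne_zero.mpr hd))
  refine Fintype.sum_equiv e _ _ fun c ↦ ?_
  have he : e c = -d * (f.coeff 0 + c) := rfl
  rw [he]
  have h4 : powerSum d f - d * c = (powerSum d f + d * f.coeff 0) + -d * (f.coeff 0 + c) := by ring
  rw [h4, AddChar.map_add_eq_mul, MulChar.pow_apply' _ hd0, MulChar.pow_apply' _ hd0]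
  have h5 : χ⁻¹ d ^ d * χ (-d * (f.coeff 0 + c)) ^ d =
      χ ((-1) ^ d * (f.coeff 0 + c)) ^ d := by
    have h6 : χ⁻¹ d * χ d = 1 := by
      rw [← MulChar.mul_apply, inv_mul_cancel, MulChar.one_apply hd.isUnit]
    have h7 : -(d : F) * (f.coeff 0 + c) =
        d * ((-1) ^ (d + 1) * ((-1) ^ d * (f.coeff 0 + c))) := by
      have : ((-1 : F) ^ d) * (-1) ^ d = 1 := by rw [← mul_pow]; simp
      linear_combination (-d * (f.coeff 0 + c)) * (-this)
    rw [h7, map_mul, map_mul, mul_pow, mul_pow, hodd, ← mul_assoc, ← mul_pow, h6]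
    simp
  rw [← h5]
  ring

/-- The Hasse-Davenport product formula. -/
theorem gaussSum_hasseDavenport (hψ : ψ ≠ 1) (hη : orderOf η ≠ 0) (hd : (orderOf η : F) ≠ 0) :
    (χ⁻¹ (orderOf η : F)) ^ orderOf η * gaussSum (χ ^ orderOf η) ψ *
        ∏ a ∈ Finset.range (orderOf η), gaussSum (η ^ a) ψ =
      -∏ a ∈ Finset.range (orderOf η), gaussSum (χ * η ^ a) ψ := by
  have h1 := card_mul_sum_charWeight χ ψ (orderOf η) hd
  have h2 := card_mul_sum_charWeight 1 ψ (orderOf η) hd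
  rw [sum_charWeight_eq_prod _ _ _ hψ hη] at h1 h2
  have h3 : gaussSum (1 : MulChar F ℂ) ψ = -1 := gaussSum_one_left hψ
  rw [one_pow, h3, inv_one, MulChar.one_apply hd.isUnit, one_pow] at h2
  simp_rw [one_mul] at h2
  have hq : (Fintype.card F : ℂ) ≠ 0 := by exact_mod_cast Fintype.card_ne_zero
  apply mul_left_cancel₀ hq
  linear_combination (χ⁻¹ (orderOf η : F)) ^ orderOf η * gaussSum (χ ^ orderOf η) ψ * h2 + h1

end HasseDavenport

section CharacterSums

variable {F : Type*} [Field F] [Fintype F] {ψ : AddChar F ℂ}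

lemma gaussSum_one_primitive (hψ : ψ.IsPrimitive) : gaussSum (1 : MulChar F ℂ) ψ = -1 :=
  gaussSum_one_left fun h ↦ by
    have := hψ one_ne_zero
    rw [h] at this
    exact this (by ext; simp)

lemma gaussSum_mul_gaussSum_inv (hψ : ψ.IsPrimitive) {χ : MulChar F ℂ} (hχ : χ ≠ 1) :
    gaussSum χ ψ * gaussSum χ⁻¹ ψ = χ (-1) * Fintype.card F := by
  rw [← gaussSum_mul_gaussSum_eq_card hχ hψ, ← mul_gaussSum_inv_eq_gaussSum χ⁻¹ ψ,
    MulChar.inv_apply', inv_neg_one]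
  ring

lemma card_ne_zero_complex : (Fintype.card F : ℂ) ≠ 0 := by
  exact_mod_cast Fintype.card_ne_zero

lemma card_sub_one_ne_zero_complex : (Fintype.card F : ℂ) - 1 ≠ 0 := by
  rw [sub_ne_zero]
  exact_mod_cast Fintype.one_lt_card.ne'

lemma MulChar.apply_neg_one_mul_self {F : Type*} [Field F] (χ : MulChar F ℂ) :
    χ (-1) * χ (-1) = 1 := by
  rw [← map_mul]
  simp

lemma gaussSum_ne_zero (hψ : ψ.IsPrimitive) (χ : MulChar F ℂ) : gaussSum χ ψ ≠ 0 := by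
  by_cases hχ : χ = 1
  · rw [hχ, gaussSum_one_primitive hψ]
    norm_num
  · exact gaussSum_ne_zero_of_nontrivial card_ne_zero_complex hχ hψ

open Classical in
lemma gaussSum_inv_mul_apply_neg_one (hψ : ψ.IsPrimitive) (χ : MulChar F ℂ) :
    gaussSum χ⁻¹ ψ * χ (-1) =
      Fintype.card F / gaussSum χ ψ + if χ = 1 then (Fintype.card F : ℂ) - 1 else 0 := by
  split_ifs with hχ
  · rw [hχ, inv_one, gaussSum_one_primitive hψ, MulChar.one_apply isUnit_one.neg]
    ring
  · rw [add_zero, eq_div_iff (gaussSum_ne_zero hψ χ)]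
    linear_combination χ (-1) * gaussSum_mul_gaussSum_inv hψ hχ +
      Fintype.card F * χ.apply_neg_one_mul_self

open Classical in
lemma MulChar.sum_eq_ite (χ : MulChar F ℂ) :
    ∑ x, χ x = if χ = 1 then (Fintype.card F : ℂ) - 1 else 0 := by
  split_ifs with h
  · rw [h, MulChar.sum_one_eq_card_units, Fintype.card_units, Nat.cast_sub Fintype.card_pos]
    simp
  · exact MulChar.sum_eq_zero_of_ne_one h

open Classical in
lemma sum_mul_pow_sum_gaussSum (ψ : AddChar F ℂ) (ρ : MulChar F ℂ) (S : Finset (MulChar F ℂ))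
    (d : ℕ) :
    ∑ s, ρ s * (∑ χ ∈ S, gaussSum χ ψ * χ⁻¹ s) ^ d =
      (Fintype.card F - 1) *
        ∑ χ ∈ (Fintype.piFinset fun _ : Fin d ↦ S).filter (fun χ ↦ ∏ i, χ i = ρ),
          ∏ i, gaussSum (χ i) ψ := by
  have h1 : ∀ s : F, (∑ χ ∈ S, gaussSum χ ψ * χ⁻¹ s) ^ d =
      ∑ χ ∈ Fintype.piFinset fun _ : Fin d ↦ S, ∏ i, gaussSum (χ i) ψ * (χ i)⁻¹ s := by
    intro s
    simpa using Finset.prod_univ_sum (fun _ : Fin d ↦ S) fun _ χ ↦ gaussSum χ ψ * χ⁻¹ s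
  simp_rw [h1, Finset.mul_sum]
  rw [Finset.sum_comm, Finset.sum_filter]
  refine Finset.sum_congr rfl fun χ _ ↦ ?_
  have h2 : ∀ s : F, ρ s * ∏ i, gaussSum (χ i) ψ * (χ i)⁻¹ s =
      (∏ i, gaussSum (χ i) ψ) * (ρ * (∏ i, χ i)⁻¹) s := by
    intro s
    rw [Finset.prod_mul_distrib, MulChar.mul_apply]
    by_cases hs : s = 0
    · simp [hs, MulChar.map_zero]
    · have h3 : ∀ T : Finset (Fin d), ∏ i ∈ T, (χ i)⁻¹ s = (∏ i ∈ T, χ i)⁻¹ s := by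
        intro T
        induction T using Finset.induction_on with
        | empty => simp [MulChar.one_apply, hs]
        | insert i T hi ih =>
          rw [Finset.prod_insert hi, Finset.prod_insert hi, ih, mul_inv, MulChar.mul_apply]
      rw [h3]
      ring
  simp_rw [h2]
  rw [← Finset.mul_sum, MulChar.sum_eq_ite]
  have h4 : ρ * (∏ i, χ i)⁻¹ = 1 ↔ ∏ i, χ i = ρ := by rw [mul_inv_eq_one, eq_comm]
  simp only [h4]
  split_ifs <;> ring

variable [Fintype (MulChar F ℂ)]

lemma MulChar.card_complex : (Fintype.card (MulChar F ℂ) : ℂ) = Fintype.card F - 1 := by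
  classical
  rw [← Nat.card_eq_fintype_card, MulChar.card_eq_card_units_of_hasEnoughRootsOfUnity,
    Nat.card_eq_fintype_card, Fintype.card_units, Nat.cast_sub Fintype.card_pos, Nat.cast_one]

open Classical in
lemma MulChar.sum_apply_eq_ite (a : F) :
    ∑ χ : MulChar F ℂ, χ a = if a = 1 then (Fintype.card F : ℂ) - 1 else 0 := by
  split_ifs with ha
  · simp [ha, MulChar.card_complex]
  · obtain ⟨χ, hχ⟩ := MulChar.exists_apply_ne_one_of_hasEnoughRootsOfUnity F ℂ ha
    refine eq_zero_of_mul_eq_self_left hχ ?_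
    simp only [Finset.mul_sum, ← MulChar.mul_apply]
    exact Fintype.sum_bijective _ (Group.mulLeft_bijective χ) _ _ fun χ' ↦ rfl

/-- Fourier expansion of an additive character into multiplicative characters. -/
lemma sum_gaussSum_inv_mul (ψ : AddChar F ℂ) {y : F} (hy : y ≠ 0) :
    ∑ χ : MulChar F ℂ, gaussSum χ⁻¹ ψ * χ y = (Fintype.card F - 1) * ψ y := by
  classical
  simp only [gaussSum, Finset.sum_mul]
  rw [Finset.sum_comm]
  have h : ∀ x : F, ∑ χ : MulChar F ℂ, χ⁻¹ x * ψ x * χ y =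
      if x = y then (Fintype.card F - 1) * ψ y else 0 := by
    intro x
    have h2 : ∑ χ : MulChar F ℂ, χ⁻¹ x * ψ x * χ y = (∑ χ : MulChar F ℂ, χ (y * x⁻¹)) * ψ x := by
      rw [Finset.sum_mul]
      refine Finset.sum_congr rfl fun χ _ ↦ ?_
      rw [map_mul, MulChar.inv_apply']
      ring
    rw [h2, MulChar.sum_apply_eq_ite]
    by_cases hxy : x = y
    · simp [hxy, hy]
    · have : y * x⁻¹ ≠ 1 := by
        rintro h
        by_cases hx : x = 0
        · simp [hx] at h
        · exact hxy ((mul_inv_eq_one₀ hx).mp h).symm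
      simp [hxy, this]
  simp_rw [h]
  simp

open Classical in
/-- The sum `∑ ρ x * ψ (z * x ^ d)` in terms of Gauss sums. -/
lemma sum_mulChar_mul_addChar_pow (ψ : AddChar F ℂ) (ρ : MulChar F ℂ) {z : F} (hz : z ≠ 0) {d : ℕ}
    (hd : d ≠ 0) :
    ∑ x, ρ x * ψ (z * x ^ d) =
      ∑ χ ∈ Finset.univ.filter (fun χ : MulChar F ℂ ↦ χ ^ d = ρ), gaussSum χ ψ * χ⁻¹ z := by
  have hq := card_sub_one_ne_zero_complex (F := F)
  apply mul_left_cancel₀ hq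
  have h1 : ∀ x : F, ((Fintype.card F : ℂ) - 1) * (ρ x * ψ (z * x ^ d)) =
      ∑ χ : MulChar F ℂ, gaussSum χ⁻¹ ψ * χ z * (ρ * χ ^ d) x := by
    intro x
    by_cases hx : x = 0
    · simp [hx, MulChar.map_zero]
    · have h := sum_gaussSum_inv_mul ψ (mul_ne_zero hz (pow_ne_zero d hx))
      calc _ = ρ x * ((Fintype.card F - 1) * ψ (z * x ^ d)) := by ring
        _ = _ := by
          rw [← h, Finset.mul_sum]
          refine Finset.sum_congr rfl fun χ _ ↦ ?_
          rw [map_mul, map_pow, MulChar.mul_apply, MulChar.pow_apply' _ hd]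
          ring
  rw [Finset.mul_sum, Finset.sum_congr rfl fun x _ ↦ h1 x, Finset.sum_comm, Finset.sum_filter,
    Finset.mul_sum, ← Equiv.sum_comp (Equiv.inv (MulChar F ℂ))]
  refine Finset.sum_congr rfl fun χ _ ↦ ?_
  rw [← Finset.mul_sum, MulChar.sum_eq_ite]
  have : ρ * χ⁻¹ ^ d = 1 ↔ χ ^ d = ρ := by
    rw [inv_pow, mul_inv_eq_one, eq_comm]
  simp only [Equiv.inv_apply, inv_inv, this]
  split_ifs <;> ring

end CharacterSums

section AffineCount

variable {F : Type*} [Field F] [Fintype F] {ψ : AddChar F ℂ}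

open Classical in
lemma card_mul_sum_ite (hψ : ψ.IsPrimitive) {X : Type*} [Fintype X] (w : X → ℂ) (P : X → F) :
    (Fintype.card F : ℂ) * ∑ x, w x * (if P x = 0 then 1 else 0) =
      ∑ s : F, ∑ x, w x * ψ (s * P x) := by
  rw [Finset.sum_comm, Finset.mul_sum]
  refine Finset.sum_congr rfl fun x _ ↦ ?_
  rw [← Finset.mul_sum, AddChar.sum_mulShift _ hψ]
  split_ifs <;> simp
  ring

lemma sum_prod_eq_pow_sum {F : Type*} [Fintype F] {d : ℕ} (f : F → ℂ) :
    ∑ x : Fin d → F, ∏ i, f (x i) = (∑ y, f y) ^ d := by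
  simpa using (Finset.prod_univ_sum (fun _ : Fin d ↦ (Finset.univ : Finset F)) fun _ y ↦ f y).symm

lemma AddChar.map_sum_pow {F : Type*} [Field F] {ψ : AddChar F ℂ} (s : F) {d : ℕ} (x : Fin d → F) :
    ψ (s * ∑ i, x i ^ d) = ∏ i, ψ (s * x i ^ d) := by
  rw [Finset.mul_sum]
  exact map_prod ψ.toMonoidHom (fun i ↦ Multiplicative.ofAdd (s * x i ^ d)) Finset.univ

lemma sum_split_zero (f : F → ℂ) : ∑ s, f s = f 0 + ∑ s, (1 : MulChar F ℂ) s * f s := by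
  classical
  rw [← sub_eq_iff_eq_add', Fintype.sum_eq_add_sum_compl 0, add_sub_cancel_left,
    Fintype.sum_eq_add_sum_compl (0 : F) fun s ↦ (1 : MulChar F ℂ) s * f s, MulChar.map_zero,
    zero_mul, zero_add]
  refine Finset.sum_congr rfl fun s hs ↦ ?_
  rw [MulChar.one_apply (isUnit_iff_ne_zero.mpr (by simpa using hs)), one_mul]

lemma prod_one_apply {F : Type*} [Field F] {d : ℕ} (x : Fin d → F) :
    ∏ i, (1 : MulChar F ℂ) (x i) = (1 : MulChar F ℂ) (∏ i, x i) := (map_prod _ _ _).symm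

variable [Fintype (MulChar F ℂ)]

open Classical in
/-- The characters whose `d`-th power is `ρ`. -/
noncomputable def mulCharRoots (d : ℕ) (ρ : MulChar F ℂ) : Finset (MulChar F ℂ) :=
  Finset.univ.filter fun χ ↦ χ ^ d = ρ

open Classical in
/-- The number of points on the affine Fermat hypersurface. -/
lemma card_mul_fermat (hψ : ψ.IsPrimitive) {d : ℕ} (hd : d ≠ 0) :
    (Fintype.card F : ℂ) * ∑ x : Fin d → F, (if ∑ i, x i ^ d = 0 then 1 else 0) =
      (Fintype.card F : ℂ) ^ d + (Fintype.card F - 1) *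
        ∑ χ ∈ (Fintype.piFinset fun _ : Fin d ↦ (mulCharRoots d (1 : MulChar F ℂ)).erase 1).filter
          (fun χ ↦ ∏ i, χ i = 1), ∏ i, gaussSum (χ i) ψ := by
  have h := card_mul_sum_ite hψ (fun _ ↦ 1) fun x : Fin d → F ↦ ∑ i, x i ^ d
  simp only [one_mul] at h
  rw [h]
  simp_rw [AddChar.map_sum_pow, fun s : F ↦ sum_prod_eq_pow_sum (d := d) fun y ↦ ψ (s * y ^ d)]
  rw [sum_split_zero, ← sum_mul_pow_sum_gaussSum]
  congr 1
  · simp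
  · refine Finset.sum_congr rfl fun s _ ↦ ?_
    by_cases hs : s = 0
    · simp [hs, MulChar.map_zero]
    · congr 2
      have h2 := sum_mulChar_mul_addChar_pow ψ 1 hs hd
      rw [sum_split_zero, h2, ← Finset.add_sum_erase _ _ (a := (1 : MulChar F ℂ)) (by simp),
        gaussSum_one_primitive hψ, inv_one, MulChar.one_apply (isUnit_iff_ne_zero.mpr hs)]
      simp [hd, mulCharRoots]

open Classical in
/-- The number of points of the Fermat hypersurface on the torus. -/
lemma card_mul_fermat_torus (hψ : ψ.IsPrimitive) {d : ℕ} (hd : d ≠ 0) :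
    (Fintype.card F : ℂ) * ∑ x : Fin d → F,
        (1 : MulChar F ℂ) (∏ i, x i) * (if ∑ i, x i ^ d = 0 then 1 else 0) =
      (Fintype.card F - 1 : ℂ) ^ d + (Fintype.card F - 1) *
        ∑ χ ∈ (Fintype.piFinset fun _ : Fin d ↦ mulCharRoots d (1 : MulChar F ℂ)).filter
          (fun χ ↦ ∏ i, χ i = 1), ∏ i, gaussSum (χ i) ψ := by
  rw [card_mul_sum_ite hψ (fun x ↦ (1 : MulChar F ℂ) (∏ i, x i)) fun x : Fin d → F ↦ ∑ i, x i ^ d]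
  simp_rw [AddChar.map_sum_pow, ← prod_one_apply, ← Finset.prod_mul_distrib,
    fun s : F ↦ sum_prod_eq_pow_sum (d := d) fun y ↦ (1 : MulChar F ℂ) y * ψ (s * y ^ d)]
  rw [sum_split_zero, ← sum_mul_pow_sum_gaussSum]
  congr 1
  · simp [MulChar.sum_eq_ite]
  · refine Finset.sum_congr rfl fun s _ ↦ ?_
    by_cases hs : s = 0
    · simp [hs, MulChar.map_zero]
    · rw [sum_mulChar_mul_addChar_pow ψ 1 hs hd, mulCharRoots]

open Classical in
/-- The number of points of the Dwork hypersurface on the torus. -/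
lemma card_mul_dwork_torus (hψ : ψ.IsPrimitive) {d : ℕ} (hd : d ≠ 0) {c : F} (hc : c ≠ 0) :
    (Fintype.card F : ℂ) * ∑ x : Fin d → F,
        (1 : MulChar F ℂ) (∏ i, x i) * (if ∑ i, x i ^ d - c * ∏ i, x i = 0 then 1 else 0) =
      (Fintype.card F - 1 : ℂ) ^ d + ∑ ρ : MulChar F ℂ, gaussSum ρ⁻¹ ψ * ρ (-c) *
        ∑ χ ∈ (Fintype.piFinset fun _ : Fin d ↦ mulCharRoots d ρ).filter
          (fun χ ↦ ∏ i, χ i = ρ), ∏ i, gaussSum (χ i) ψ := by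
  have hq := card_sub_one_ne_zero_complex (F := F)
  rw [card_mul_sum_ite hψ (fun x ↦ (1 : MulChar F ℂ) (∏ i, x i))
    fun x : Fin d → F ↦ ∑ i, x i ^ d - c * ∏ i, x i, sum_split_zero]
  congr 1
  · simp only [zero_mul, AddChar.map_zero_eq_one, mul_one, ← prod_one_apply]
    rw [sum_prod_eq_pow_sum]
    simp [MulChar.sum_eq_ite]
  · apply mul_left_cancel₀ hq
    have h1 : ∀ s : F, ((Fintype.card F : ℂ) - 1) * ((1 : MulChar F ℂ) s * ∑ x : Fin d → F,
        (1 : MulChar F ℂ) (∏ i, x i) * ψ (s * (∑ i, x i ^ d - c * ∏ i, x i))) =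
        ∑ ρ : MulChar F ℂ, gaussSum ρ⁻¹ ψ * ρ (-c) *
          (ρ s * (∑ χ ∈ mulCharRoots d ρ, gaussSum χ ψ * χ⁻¹ s) ^ d) := by
      intro s
      by_cases hs : s = 0
      · simp [hs, MulChar.map_zero]
      have h2 : ∀ x : Fin d → F, ((Fintype.card F : ℂ) - 1) * ((1 : MulChar F ℂ) (∏ i, x i) *
          ψ (s * (∑ i, x i ^ d - c * ∏ i, x i))) = ∑ ρ : MulChar F ℂ,
            gaussSum ρ⁻¹ ψ * ρ (-c) * ρ s * ∏ i, ρ (x i) * ψ (s * x i ^ d) := by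
        intro x
        by_cases hx : ∏ i, x i = 0
        · have h3 : ∀ ρ : MulChar F ℂ, ∏ i, ρ (x i) = 0 := fun ρ ↦ by
            rw [← map_prod, hx, MulChar.map_zero]
          simp [hx, h3, Finset.prod_mul_distrib, MulChar.map_zero]
        · have h3 := sum_gaussSum_inv_mul ψ (mul_ne_zero (mul_ne_zero (neg_ne_zero.mpr hc) hs) hx)
          have h4 : s * (∑ i, x i ^ d - c * ∏ i, x i) = -c * s * ∏ i, x i + s * ∑ i, x i ^ d := by
            ring
          rw [MulChar.one_apply (isUnit_iff_ne_zero.mpr hx), one_mul, h4, AddChar.map_add_eq_mul,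
            ← mul_assoc, ← h3, Finset.sum_mul]
          refine Finset.sum_congr rfl fun ρ _ ↦ ?_
          rw [AddChar.map_sum_pow, Finset.prod_mul_distrib, map_mul, map_mul, map_prod]
          ring
      rw [MulChar.one_apply (isUnit_iff_ne_zero.mpr hs), one_mul, Finset.mul_sum,
        Finset.sum_congr rfl fun x _ ↦ h2 x, Finset.sum_comm]
      refine Finset.sum_congr rfl fun ρ _ ↦ ?_
      rw [← Finset.mul_sum, sum_prod_eq_pow_sum fun y : F ↦ ρ y * ψ (s * y ^ d),
        sum_mulChar_mul_addChar_pow ψ ρ hs hd, mulCharRoots, mul_assoc]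
    rw [Finset.mul_sum, Finset.sum_congr rfl fun s _ ↦ h1 s, Finset.sum_comm, Finset.mul_sum]
    refine Finset.sum_congr rfl fun ρ _ ↦ ?_
    rw [← Finset.mul_sum, sum_mul_pow_sum_gaussSum]
    ring

open Classical in
/-- The number of affine solutions of the Dwork equation in terms of Gauss sums. -/
lemma card_mul_dwork_affine (hψ : ψ.IsPrimitive) {d : ℕ} (hd : d ≠ 0) {c : F} (hc : c ≠ 0) :
    (Fintype.card F : ℂ) *
        (Finset.univ.filter fun x : Fin d → F ↦ ∑ i, x i ^ d = c * ∏ i, x i).card =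
      (Fintype.card F : ℂ) ^ d + (Fintype.card F - 1) *
        ∑ χ ∈ (Fintype.piFinset fun _ : Fin d ↦ (mulCharRoots d (1 : MulChar F ℂ)).erase 1).filter
          (fun χ ↦ ∏ i, χ i = 1), ∏ i, gaussSum (χ i) ψ +
      Fintype.card F * ∑ ρ : MulChar F ℂ, ρ c / gaussSum ρ ψ *
        ∑ χ ∈ (Fintype.piFinset fun _ : Fin d ↦ mulCharRoots d ρ).filter
          (fun χ ↦ ∏ i, χ i = ρ), ∏ i, gaussSum (χ i) ψ := by
  have h1 : ((Finset.univ.filter fun x : Fin d → F ↦ ∑ i, x i ^ d = c * ∏ i, x i).card : ℂ) =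
      ∑ x : Fin d → F, (if ∑ i, x i ^ d = 0 then 1 else 0) +
      ∑ x : Fin d → F, (1 : MulChar F ℂ) (∏ i, x i) *
        (if ∑ i, x i ^ d - c * ∏ i, x i = 0 then 1 else 0) -
      ∑ x : Fin d → F, (1 : MulChar F ℂ) (∏ i, x i) * (if ∑ i, x i ^ d = 0 then 1 else 0) := by
    rw [← Finset.sum_add_distrib, ← Finset.sum_sub_distrib, Finset.card_filter, Nat.cast_sum]
    refine Finset.sum_congr rfl fun x _ ↦ ?_
    by_cases hx : ∏ i, x i = 0
    · simp [hx, MulChar.map_zero]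
    · simp only [MulChar.one_apply (isUnit_iff_ne_zero.mpr hx), sub_eq_zero]
      push_cast
      ring
  rw [h1, mul_sub, mul_add, card_mul_fermat hψ hd, card_mul_fermat_torus hψ hd,
    card_mul_dwork_torus hψ hd hc]
  have h2 : ∑ ρ : MulChar F ℂ, gaussSum ρ⁻¹ ψ * ρ (-c) *
        ∑ χ ∈ (Fintype.piFinset fun _ : Fin d ↦ mulCharRoots d ρ).filter
          (fun χ ↦ ∏ i, χ i = ρ), ∏ i, gaussSum (χ i) ψ =
      Fintype.card F * ∑ ρ : MulChar F ℂ, ρ c / gaussSum ρ ψ *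
        ∑ χ ∈ (Fintype.piFinset fun _ : Fin d ↦ mulCharRoots d ρ).filter
          (fun χ ↦ ∏ i, χ i = ρ), ∏ i, gaussSum (χ i) ψ +
      (Fintype.card F - 1) *
        ∑ χ ∈ (Fintype.piFinset fun _ : Fin d ↦ mulCharRoots d (1 : MulChar F ℂ)).filter
          (fun χ ↦ ∏ i, χ i = 1), ∏ i, gaussSum (χ i) ψ := by
    set A := fun ρ : MulChar F ℂ ↦
      ∑ χ ∈ (Fintype.piFinset fun _ : Fin d ↦ mulCharRoots d ρ).filter
          (fun χ ↦ ∏ i, χ i = ρ), ∏ i, gaussSum (χ i) ψ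
    have h3 : ∀ ρ : MulChar F ℂ, gaussSum ρ⁻¹ ψ * ρ (-c) * A ρ =
        Fintype.card F * (ρ c / gaussSum ρ ψ * A ρ) +
          if ρ = 1 then (Fintype.card F - 1) * A 1 else 0 := by
      intro ρ
      have h4 := gaussSum_inv_mul_apply_neg_one hψ ρ
      rw [neg_eq_neg_one_mul, map_mul, ← mul_assoc, h4]
      split_ifs with hρ
      · rw [hρ, MulChar.one_apply hc.isUnit]
        ring
      · ring
    change ∑ ρ : MulChar F ℂ, gaussSum ρ⁻¹ ψ * ρ (-c) * A ρ = _
    rw [Finset.sum_congr rfl fun ρ _ ↦ h3 ρ, Finset.sum_add_distrib, ← Finset.mul_sum,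
      Finset.sum_ite_eq', if_pos (Finset.mem_univ _)]
  rw [h2]
  ring

end AffineCount

section RootsOfUnity

variable {G : Type*} [CommGroup G] {d : ℕ} {η : G}

lemma pow_val_pow (hη : orderOf η = d) (a : ZMod d) : (η ^ a.val) ^ d = 1 := by
  rw [← pow_mul, ← orderOf_dvd_iff_pow_eq_one, hη]
  exact dvd_mul_left _ _

variable [NeZero d]

lemma pow_val_add (hη : orderOf η = d) (a b : ZMod d) :
    η ^ (a + b).val = η ^ a.val * η ^ b.val := by
  rw [ZMod.val_add, ← pow_add, pow_eq_pow_iff_modEq, hη]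
  exact Nat.mod_modEq _ _

lemma pow_val_neg (hη : orderOf η = d) (a : ZMod d) : η ^ (-a).val = (η ^ a.val)⁻¹ :=
  eq_inv_of_mul_eq_one_left (by rw [← pow_val_add hη]; simp)

lemma pow_val_injective (hη : orderOf η = d) : Function.Injective fun a : ZMod d ↦ η ^ a.val := by
  intro a b h
  refine ZMod.val_injective d (pow_injOn_Iio_orderOf ?_ ?_ h) <;>
    simpa [hη] using ZMod.val_lt _

lemma pow_val_eq_one (hη : orderOf η = d) {a : ZMod d} : η ^ a.val = 1 ↔ a = 0 := by
  rw [← (pow_val_injective hη).eq_iff (a := a)]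
  simp

lemma prod_pow_val (hη : orderOf η = d) {ι : Type*} (s : Finset ι) (w : ι → ZMod d) :
    ∏ i ∈ s, η ^ (w i).val = η ^ (∑ i ∈ s, w i).val := by
  classical
  induction s using Finset.induction_on with
  | empty => simp
  | insert i s hi ih => rw [Finset.prod_insert hi, Finset.sum_insert hi, pow_val_add hη, ih]

lemma exists_pow_val_eq [IsCyclic G] [Finite G] (hη : orderOf η = d) {χ : G} (hχ : χ ^ d = 1) :
    ∃ a : ZMod d, η ^ a.val = χ := by
  classical
  have := Fintype.ofFinite G
  have h : Finset.univ.image (fun a : ZMod d ↦ η ^ a.val) =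
      Finset.univ.filter fun x : G ↦ x ^ d = 1 := by
    refine Finset.eq_of_subset_of_card_le ?_ ?_
    · intro x
      simp only [Finset.mem_image, Finset.mem_univ, true_and, Finset.mem_filter]
      rintro ⟨a, rfl⟩
      exact pow_val_pow hη a
    · rw [Finset.card_image_of_injective _ (pow_val_injective hη), Finset.card_univ, ZMod.card]
      exact IsCyclic.card_pow_eq_one_le (NeZero.pos d)
  have h2 : χ ∈ Finset.univ.filter fun x : G ↦ x ^ d = 1 := by simpa using hχ
  rw [← h] at h2
  simpa using h2

lemma sum_piFinset_prod_eq [IsCyclic G] [Fintype G] [DecidableEq G] (hη : orderOf η = d) {M : Type*}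
    [AddCommMonoid M] (V : Finset (Fin d → ZMod d)) (hV : ∀ v ∈ V, ∑ i, v i = 0)
    (hVrep : ∀ w : Fin d → ZMod d, ∑ i, w i = 0 → ∃! v, v ∈ V ∧ ∃ c, ∀ i, w i = v i + c)
    (f : G → (Fin d → G) → M) :
    ∑ ρ : G, ∑ χ ∈ (Fintype.piFinset fun _ : Fin d ↦
        Finset.univ.filter fun χ : G ↦ χ ^ d = ρ).filter (fun χ ↦ ∏ i, χ i = ρ), f ρ χ =
      ∑ v ∈ V, ∑ χ : G, f (χ ^ d) fun i ↦ χ * η ^ (v i).val := by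
  rw [Finset.sum_sigma', ← Finset.sum_product']
  refine (Finset.sum_bij (fun (x : (Fin d → ZMod d) × G) _ ↦
    (⟨x.2 ^ d, fun i ↦ x.2 * η ^ (x.1 i).val⟩ : Σ _ : G, Fin d → G)) ?_ ?_ ?_ ?_).symm
  · rintro ⟨v, χ⟩ hx
    rw [Finset.mem_product] at hx
    simp [mul_pow, pow_val_pow hη, Finset.prod_mul_distrib, prod_pow_val hη, hV v hx.1]
  · rintro ⟨v, χ⟩ hx ⟨v', χ'⟩ hx' h
    simp only [Finset.mem_product, Finset.mem_univ, and_true] at hx hx'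
    have h1 : ∀ i, χ * η ^ (v i).val = χ' * η ^ (v' i).val :=
      fun i ↦ congrFun (eq_of_heq (Sigma.mk.inj h).2) i
    have h2 : v = v' := by
      refine (hVrep v (hV v hx)).unique ⟨hx, 0, by simp⟩ ⟨hx', v 0 - v' 0, fun i ↦ ?_⟩
      refine pow_val_injective hη ?_
      have h3 := congrArg₂ (· * ·) (h1 i) (h1 0).symm
      simp only [sub_eq_add_neg, pow_val_add hη, pow_val_neg hη] at h3 ⊢
      rw [← mul_assoc, eq_mul_inv_iff_mul_eq]
      refine mul_left_cancel (a := χ * χ') ?_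
      calc _ = χ * η ^ (v i).val * (χ' * η ^ (v' 0).val) := by
            rw [mul_mul_mul_comm]
        _ = _ := by rw [h3, mul_mul_mul_comm, mul_comm χ' χ]
    rw [h2] at h1 ⊢
    rw [mul_right_cancel (h1 0)]
  · rintro ⟨ρ, x⟩ hx
    simp only [Finset.mem_sigma, Finset.mem_univ, Finset.mem_filter, Fintype.mem_piFinset,
      true_and] at hx
    obtain ⟨hx1, hx2⟩ := hx
    have h1 : ∀ i, ∃ a : ZMod d, η ^ a.val = (x 0)⁻¹ * x i := fun i ↦
      exists_pow_val_eq hη (by rw [mul_pow, inv_pow, hx1, hx1, inv_mul_cancel])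
    choose w hw using h1
    have h2 : ∑ i, w i = 0 := by
      rw [← pow_val_eq_one hη, ← prod_pow_val hη]
      simp_rw [hw]
      rw [Finset.prod_mul_distrib, hx2]
      simp [hx1]
    obtain ⟨v, ⟨hv, c, hc⟩, -⟩ := hVrep w h2
    have h3 : ∀ i, x 0 * η ^ c.val * η ^ (v i).val = x i := by
      intro i
      rw [mul_assoc, ← pow_val_add hη, add_comm, ← hc, hw, mul_inv_cancel_left]
    refine ⟨⟨v, x 0 * η ^ c.val⟩, by simpa using hv, ?_⟩
    simp only [h3, mul_pow, pow_val_pow hη, mul_one, hx1]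
  · intros
    rfl

lemma sum_piFinset_erase_one [IsCyclic G] [Fintype G] [DecidableEq G] (hη : orderOf η = d) {M : Type*}
    [AddCommMonoid M] (f : (Fin d → G) → M) :
    ∑ χ ∈ (Fintype.piFinset fun _ : Fin d ↦
        (Finset.univ.filter fun χ : G ↦ χ ^ d = 1).erase 1).filter (fun χ ↦ ∏ i, χ i = 1), f χ =
      ∑ w : Fin d → ZMod d with ∑ i, w i = 0 ∧ ∀ i, w i ≠ 0, f fun i ↦ η ^ (w i).val := by
  refine (Finset.sum_bij (fun w _ i ↦ η ^ (w i).val) ?_ ?_ ?_ ?_).symm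
  · intro w hw
    simp only [Finset.mem_filter, Finset.mem_univ, true_and] at hw
    simp [pow_val_pow hη, prod_pow_val hη, hw.1, pow_val_eq_one hη, hw.2]
  · intro w _ w' _ h
    ext i : 1
    exact (pow_val_injective hη (congrFun h i))
  · intro x hx
    simp only [Finset.mem_filter, Fintype.mem_piFinset, Finset.mem_erase, Finset.mem_univ,
      true_and] at hx
    choose w hw using fun i ↦ exists_pow_val_eq hη (hx.1 i).2
    refine ⟨w, ?_, funext hw⟩
    simp only [Finset.mem_filter, Finset.mem_univ, true_and, ← pow_val_eq_one hη, ne_eq,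
      ← prod_pow_val hη, hw]
    exact ⟨hx.2, fun i ↦ (hx.1 i).1⟩
  · intros
    rfl

end RootsOfUnity

lemma Projectivization.card_rep_mul_card_units {k V : Type*} [DivisionRing k] [AddCommGroup V]
    [Module k V] (Q : V → Prop) (hQ : ∀ (u : kˣ) v, Q (u • v) ↔ Q v) :
    Nat.card {P : Projectivization k V // Q P.rep} * Nat.card kˣ =
      Nat.card {v : V // v ≠ 0 ∧ Q v} := by
  rw [← Nat.card_prod]
  refine Nat.card_eq_of_bijective (fun x ↦ ⟨x.2 • x.1.1.rep,
    (smul_ne_zero_iff_ne x.2).mpr x.1.1.rep_nonzero, (hQ _ _).mpr x.1.2⟩) ⟨?_, ?_⟩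
  · rintro ⟨⟨P, hP⟩, u⟩ ⟨⟨P', hP'⟩, u'⟩ h
    simp only [Subtype.mk.injEq] at h
    have h1 : P = P' := by
      rw [← P.mk_rep, ← P'.mk_rep, Projectivization.mk_eq_mk_iff]
      exact ⟨u⁻¹ * u', by rw [mul_smul, ← h, inv_smul_smul]⟩
    subst h1
    have h2 : (u : k) = u' := smul_left_injective k P.rep_nonzero h
    rw [Units.ext h2]
  · rintro ⟨v, hv, hQv⟩
    obtain ⟨a, ha⟩ := Projectivization.exists_smul_eq_mk_rep k v hv
    refine ⟨⟨⟨Projectivization.mk k v hv, ?_⟩, a⁻¹⟩, ?_⟩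
    · rw [← ha, hQ]
      exact hQv
    · simp only [← ha, inv_smul_smul]

open Classical in
/-- The relation between the projective and the affine Dwork point counts. -/
lemma dworkHypersurfaceCount_mul {F : Type*} [Field F] [Fintype F] {d : ℕ} (hd : d ≠ 0)
    (lam : F) :
    (dworkHypersurfaceCount F d lam : ℂ) * (Fintype.card F - 1) =
      (Finset.univ.filter fun x : Fin d → F ↦ ∑ i, x i ^ d = d * lam * ∏ i, x i).card - 1 := by
  have : Nonempty (Fin d) := ⟨0, Nat.pos_of_ne_zero hd⟩
  set Q := fun x : Fin d → F ↦ ∑ i, x i ^ d = d * lam * ∏ i, x i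
  have h1 := Projectivization.card_rep_mul_card_units (k := F) Q (fun u v ↦ by
    simp only [Q, Pi.smul_apply, Units.smul_def, smul_eq_mul, mul_pow, ← Finset.mul_sum,
      Finset.prod_mul_distrib, Finset.prod_const, Finset.card_univ, Fintype.card_fin]
    rw [mul_left_comm, mul_right_inj' (pow_ne_zero d u.ne_zero)])
  have h2 : Finset.univ.filter (fun x ↦ x ≠ 0 ∧ Q x) = (Finset.univ.filter Q).erase 0 := by
    ext x
    simp
  have h3 : (0 : Fin d → F) ∈ Finset.univ.filter Q := by
    simp [Q, hd]
  rw [Nat.card_eq_fintype_card (α := {v : Fin d → F // v ≠ 0 ∧ Q v}), Fintype.card_subtype, h2,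
    Finset.card_erase_of_mem h3, Nat.card_eq_fintype_card (α := Fˣ), Fintype.card_units] at h1
  have h4 := congrArg (Nat.cast (R := ℂ)) h1
  rw [Nat.cast_mul, Nat.cast_sub Fintype.card_pos,
    Nat.cast_sub (Finset.card_pos.mpr ⟨0, h3⟩), Nat.cast_one] at h4
  exact h4

section HypergeometricEvaluation

variable {F : Type*} [Field F] [Fintype F] {ψ : AddChar F ℂ}

lemma jacB_mul_gaussSum (ψ : AddChar F ℂ) {α χ : MulChar F ℂ} (hα : α ≠ 1) :
    Fintype.card F * gaussSum α ψ * jacB (α * χ) χ =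
      χ (-1) * gaussSum χ⁻¹ ψ * gaussSum (χ * α) ψ := by
  have h := jacobiSum_mul_nontrivial (χ := α * χ) (φ := χ⁻¹) (by simpa using hα) ψ
  rw [mul_inv_cancel_right] at h
  have h2 : ∑ x : F, (α * χ) x * χ⁻¹ (1 - x) = jacobiSum (α * χ) χ⁻¹ := rfl
  rw [jacB, h2, mul_comm χ α]
  have := card_ne_zero_complex (F := F)
  field_simp
  linear_combination χ (-1) * h

lemma prod_jacB_mul_gaussSum (hψ : ψ.IsPrimitive) {η : MulChar F ℂ} {n : ℕ}
    (hη : orderOf η = n + 1) (hn : ((n + 1 : ℕ) : F) ≠ 0) (χ : MulChar F ℂ) :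
    (Fintype.card F : ℂ) ^ n * (∏ a ∈ Finset.range n, jacB (η ^ (a + 1) * χ) χ) * gaussSum χ ψ =
      (χ (-1) * gaussSum χ⁻¹ ψ) ^ n * (χ⁻¹ ((n + 1 : ℕ) : F)) ^ (n + 1) *
        gaussSum (χ ^ (n + 1)) ψ := by
  have hne : ψ ≠ 1 := fun h ↦ by
    have := hψ one_ne_zero
    rw [h] at this
    exact this (by ext; simp)
  have hHD := gaussSum_hasseDavenport χ η ψ hne (by rw [hη]; exact n.succ_ne_zero)
    (by rwa [hη])
  rw [hη, Finset.prod_range_succ', Finset.prod_range_succ', pow_zero, mul_one,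
    gaussSum_one_primitive hψ] at hHD
  have h1 : (∏ a ∈ Finset.range n, gaussSum (η ^ (a + 1)) ψ) ≠ 0 :=
    Finset.prod_ne_zero_iff.mpr fun a _ ↦ gaussSum_ne_zero hψ _
  have h2 : (Fintype.card F : ℂ) ^ n * (∏ a ∈ Finset.range n, gaussSum (η ^ (a + 1)) ψ) *
      ∏ a ∈ Finset.range n, jacB (η ^ (a + 1) * χ) χ =
      (χ (-1) * gaussSum χ⁻¹ ψ) ^ n * ∏ a ∈ Finset.range n, gaussSum (χ * η ^ (a + 1)) ψ := by
    rw [← Finset.card_range n, ← Finset.prod_const, ← Finset.prod_const, Finset.card_range,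
      ← Finset.prod_mul_distrib, ← Finset.prod_mul_distrib, ← Finset.prod_mul_distrib]
    refine Finset.prod_congr rfl fun a ha ↦ jacB_mul_gaussSum ψ ?_
    refine pow_ne_one_of_lt_orderOf a.succ_ne_zero ?_
    rw [hη]
    exact Nat.succ_lt_succ (Finset.mem_range.mp ha)
  apply mul_left_cancel₀ h1
  linear_combination gaussSum χ ψ * h2 + (χ (-1) * gaussSum χ⁻¹ ψ) ^ n * hHD

open Classical in
lemma prod_jacB_mul_apply (hψ : ψ.IsPrimitive) {η : MulChar F ℂ} {n : ℕ}
    (hη : orderOf η = n + 1) (hn : ((n + 1 : ℕ) : F) ≠ 0) {x : F} (hx : x ≠ 0)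
    (χ : MulChar F ℂ) :
    (Fintype.card F : ℂ) ^ n * (∏ a ∈ Finset.range n, jacB (η ^ (a + 1) * χ) χ) *
        χ (x ^ (n + 1))⁻¹ =
      (χ⁻¹ ^ (n + 1)) ((n + 1 : ℕ) * x) / gaussSum (χ⁻¹ ^ (n + 1)) ψ *
          gaussSum χ⁻¹ ψ ^ (n + 1) +
        if χ⁻¹ ^ (n + 1) = 1 ∧ χ⁻¹ ≠ 1 then
          (Fintype.card F - 1) / Fintype.card F * gaussSum χ⁻¹ ψ ^ (n + 1) else 0 := by
  have h := prod_jacB_mul_gaussSum hψ hη hn χ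
  have hX : (χ⁻¹ ^ (n + 1)) ((n + 1 : ℕ) * x) =
      (χ⁻¹ ((n + 1 : ℕ) : F)) ^ (n + 1) * χ (x ^ (n + 1))⁻¹ := by
    rw [MulChar.pow_apply' _ n.succ_ne_zero, map_mul, mul_pow, MulChar.inv_apply' χ x, ← inv_pow,
      map_pow χ]
  have h' : (Fintype.card F : ℂ) ^ n * (∏ a ∈ Finset.range n, jacB (η ^ (a + 1) * χ) χ) *
      χ (x ^ (n + 1))⁻¹ = (χ (-1) * gaussSum χ⁻¹ ψ) ^ n * (χ⁻¹ ^ (n + 1)) ((n + 1 : ℕ) * x) *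
        gaussSum (χ ^ (n + 1)) ψ / gaussSum χ ψ := by
    rw [eq_div_iff (gaussSum_ne_zero hψ χ), hX]
    linear_combination χ (x ^ (n + 1))⁻¹ * h
  rw [h']
  have hg := gaussSum_ne_zero hψ χ
  have hg' := gaussSum_ne_zero hψ χ⁻¹
  have hq := card_ne_zero_complex (F := F)
  have hu := χ.apply_neg_one_mul_self
  have hxd : IsUnit (((n + 1 : ℕ) : F) * x) := (mul_ne_zero hn hx).isUnit
  by_cases h1 : χ = 1
  · simp only [h1, inv_one, one_pow, MulChar.one_apply hxd, gaussSum_one_primitive hψ,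
      MulChar.one_apply isUnit_one.neg, ne_eq, not_true_eq_false, and_false, if_false]
    ring
  have hgg := gaussSum_mul_gaussSum_inv hψ h1
  have hu0 : χ (-1) ≠ 0 := left_ne_zero_of_mul_eq_one hu
  have hg2 : gaussSum χ ψ = χ (-1) * Fintype.card F / gaussSum χ⁻¹ ψ := by
    rw [eq_div_iff hg', hgg]
  by_cases h2 : χ ^ (n + 1) = 1
  · have hun : χ (-1) ^ (n + 1) = 1 := by
      rw [← MulChar.pow_apply' _ n.succ_ne_zero, h2, MulChar.one_apply isUnit_one.neg]
    rw [inv_pow, h2, inv_one, if_pos ⟨rfl, by simpa using h1⟩, MulChar.one_apply hxd,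
      gaussSum_one_primitive hψ, hg2]
    have hun' : χ (-1) ^ n = χ (-1) := by linear_combination χ (-1) * hun - χ (-1) ^ n * hu
    rw [mul_pow, hun']
    field_simp
    ring
  · have hgd := gaussSum_mul_gaussSum_inv hψ h2
    rw [inv_pow, if_neg (by simp [h2])]
    have hgd' := gaussSum_ne_zero hψ (χ ^ (n + 1))⁻¹
    rw [MulChar.pow_apply' _ n.succ_ne_zero] at hgd
    have hgd2 : gaussSum (χ ^ (n + 1)) ψ =
        χ (-1) ^ (n + 1) * Fintype.card F / gaussSum (χ ^ (n + 1))⁻¹ ψ := by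
      rw [eq_div_iff hgd', hgd]
    have hun : χ (-1) ^ n * χ (-1) ^ n = 1 := by rw [← mul_pow, hu, one_pow]
    rw [hgd2, hg2, mul_pow]
    field_simp
    linear_combination χ (-1) * gaussSum χ⁻¹ ψ ^ (n + 1) *
      (χ ^ (n + 1))⁻¹ ((n + 1 : ℕ) * x) * hun

/-- Evaluation of Greene's function at the parameters of the Dwork family. -/
lemma card_pow_mul_greeneF [Fintype (MulChar F ℂ)] [IsCyclic (MulChar F ℂ)] (hψ : ψ.IsPrimitive)
    {η : MulChar F ℂ} {d : ℕ} [NeZero d] (hη : orderOf η = d) (hd : 2 ≤ d) (hdF : (d : F) ≠ 0)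
    {x : F} (hx : x ≠ 0) :
    (Fintype.card F : ℂ) ^ (d - 2) *
        greeneF (d - 2) (fun i : Fin (d - 2 + 1) ↦ η ^ ((i : ℕ) + 1)) (fun _ ↦ 1) (x ^ d)⁻¹ =
      1 / (Fintype.card F - 1) *
          ∑ χ : MulChar F ℂ, (χ ^ d) (d * x) / gaussSum (χ ^ d) ψ * gaussSum χ ψ ^ d +
        1 / Fintype.card F * ∑ a : ZMod d with a ≠ 0, gaussSum (η ^ a.val) ψ ^ d := by
  classical
  have hq := card_ne_zero_complex (F := F)
  have hq1 := card_sub_one_ne_zero_complex (F := F)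
  set R := fun χ : MulChar F ℂ ↦
    (χ ^ d) (d * x) / gaussSum (χ ^ d) ψ * gaussSum χ ψ ^ d +
      if χ ^ d = 1 ∧ χ ≠ 1 then
        (Fintype.card F - 1) / Fintype.card F * gaussSum χ ψ ^ d else 0 with hR
  have h1 : ∀ χ : MulChar F ℂ, (Fintype.card F : ℂ) ^ (d - 1) *
      ((jacB (η ^ (((0 : Fin (d - 2 + 1)) : ℕ) + 1) * χ) χ *
        ∏ i : Fin (d - 2), jacB (η ^ ((i.succ : ℕ) + 1) * χ) (1 * χ)) * χ (x ^ d)⁻¹) = R χ⁻¹ := by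
    intro χ
    have h2 : d - 1 + 1 = d := by omega
    have h3 : d - 2 + 1 = d - 1 := by omega
    have h := prod_jacB_mul_apply hψ (n := d - 1) (by rw [hη, h2]) (by rwa [h2]) hx χ
    rw [h2] at h
    simp only [hR]
    rw [← h, one_mul, ← Fin.prod_univ_succ (n := d - 2)
      (f := fun i ↦ jacB (η ^ ((i : ℕ) + 1) * χ) χ),
      Fin.prod_univ_eq_prod_range (fun i ↦ jacB (η ^ (i + 1) * χ) χ), h3, mul_assoc]
  have h4 : (Fintype.card F : ℂ) ^ (d - 1) = Fintype.card F ^ (d - 2) * Fintype.card F := by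
    rw [← pow_succ]
    congr 1
    omega
  have h5 : ∑ χ : MulChar F ℂ, (if χ ^ d = 1 ∧ χ ≠ 1 then
      (Fintype.card F - 1) / Fintype.card F * gaussSum χ ψ ^ d else 0) =
      (Fintype.card F - 1) / Fintype.card F *
        ∑ a : ZMod d with a ≠ 0, gaussSum (η ^ a.val) ψ ^ d := by
    rw [← Finset.sum_filter, Finset.mul_sum]
    refine (Finset.sum_bij (fun a _ ↦ η ^ a.val) ?_ ?_ ?_ ?_).symm
    · intro a ha
      simpa [pow_val_pow hη, pow_val_eq_one hη] using ha
    · exact fun a _ b _ h ↦ pow_val_injective hη h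
    · intro χ hχ
      simp only [Finset.mem_filter, Finset.mem_univ, true_and] at hχ
      obtain ⟨a, rfl⟩ := exists_pow_val_eq hη hχ.1
      exact ⟨a, by simpa [pow_val_eq_one hη] using hχ.2, rfl⟩
    · intros
      rfl
  have h6 : ∑ χ : MulChar F ℂ, R χ⁻¹ = ∑ χ : MulChar F ℂ, R χ :=
    Equiv.sum_comp (Equiv.inv (MulChar F ℂ)) R
  simp_rw [← h1, ← Finset.mul_sum] at h6
  rw [hR, Finset.sum_add_distrib, h5, h4] at h6
  have h7 : 1 / (Fintype.card F : ℂ) =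
      1 / (Fintype.card F - 1) * ((Fintype.card F - 1) / Fintype.card F) := by field_simp
  rw [greeneF, finsum_eq_sum_of_fintype, h7]
  linear_combination 1 / ((Fintype.card F : ℂ) - 1) * h6

end HypergeometricEvaluation

lemma sum_zero_sum_filter_ne_zero {d : ℕ} [NeZero d] (f : (Fin d → ZMod d) → ℂ) :
    ∑ w : Fin d → ZMod d with ∑ i, w i = 0 ∧ ∀ i, w i ≠ 0, f w =
      ∑ᶠ w ∈ {w : Fin d → ZMod d |
        (∑ i, w i = 0) ∧ (∀ i, w i ≠ 0) ∧ ¬∃ c : ZMod d, ∀ i, w i = c}, f w +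
      ∑ a : ZMod d with a ≠ 0, f fun _ ↦ a := by
  classical
  rw [← Finset.sum_filter_not_add_sum_filter _ fun w : Fin d → ZMod d ↦ ∃ c, ∀ i, w i = c]
  congr 1
  · rw [finsum_mem_eq_finite_toFinset_sum _ (Set.toFinite _)]
    refine Finset.sum_congr ?_ fun _ _ ↦ rfl
    ext w
    simp [and_assoc]
  · refine (Finset.sum_bij (fun a _ _ ↦ a) ?_ ?_ ?_ ?_).symm
    · intro a ha
      simpa using ha
    · exact fun a _ b _ h ↦ congrFun h 0
    · intro w hw
      simp only [Finset.mem_filter, Finset.mem_univ, true_and] at hw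
      obtain ⟨⟨-, hw⟩, c, hc⟩ := hw
      exact ⟨c, by simpa [hc] using hw 0, funext fun i ↦ (hc i).symm⟩
    · intros
      rfl

open Classical in
/-- The point count of the Dwork hypersurface as a sum of products of Gauss sums. -/
lemma dworkHypersurfaceCount_eq {F : Type*} [Field F] [Fintype F] [Fintype (MulChar F ℂ)]
    [IsCyclic (MulChar F ℂ)] {ψ : AddChar F ℂ} (hψ : ψ.IsPrimitive) {η : MulChar F ℂ} {d : ℕ}
    [NeZero d] (hη : orderOf η = d) (hdF : (d : F) ≠ 0) {lam : F} (hlam : lam ≠ 0)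
    (V : Finset (Fin d → ZMod d)) (hV : ∀ v ∈ V, ∑ i, v i = 0)
    (hVrep : ∀ w : Fin d → ZMod d, ∑ i, w i = 0 → ∃! v, v ∈ V ∧ ∃ c, ∀ i, w i = v i + c) :
    (dworkHypersurfaceCount F d lam : ℂ) =
      ((Fintype.card F : ℂ) ^ (d - 1) - 1) / (Fintype.card F - 1) +
        1 / Fintype.card F * ∑ w : Fin d → ZMod d with ∑ i, w i = 0 ∧ ∀ i, w i ≠ 0,
          ∏ i, gaussSum (η ^ (w i).val) ψ +
        1 / (Fintype.card F - 1) * ∑ v ∈ V, ∑ χ : MulChar F ℂ,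
          (χ ^ d) (d * lam) / gaussSum (χ ^ d) ψ * ∏ i, gaussSum (χ * η ^ (v i).val) ψ := by
  have hq := card_ne_zero_complex (F := F)
  have hq1 := card_sub_one_ne_zero_complex (F := F)
  have h1 := dworkHypersurfaceCount_mul (NeZero.ne d) lam
  have h2 := card_mul_dwork_affine hψ (NeZero.ne d) (mul_ne_zero hdF hlam)
  simp only [mulCharRoots, Finset.mul_sum] at h2
  rw [sum_piFinset_prod_eq hη V hV hVrep fun ρ χ ↦
    Fintype.card F * (ρ (d * lam) / gaussSum ρ ψ * ∏ i, gaussSum (χ i) ψ),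
    sum_piFinset_erase_one hη fun χ ↦
      ((Fintype.card F : ℂ) - 1) * ∏ i, gaussSum (χ i) ψ] at h2
  simp only [← Finset.mul_sum] at h2
  have h3 : (Fintype.card F : ℂ) ^ d = Fintype.card F ^ (d - 1) * Fintype.card F := by
    rw [← pow_succ, Nat.sub_add_cancel (NeZero.pos d)]
  rw [h3] at h2
  rw [← mul_left_inj' hq1, ← mul_right_inj' hq, h1, mul_sub, h2]
  field_simp
  ring

lemma IsCyclic.sum_eq_sum_range_orderOf {G : Type*} [Group G] [Fintype G] {g : G}
    (hg : ∀ x : G, x ∈ Subgroup.zpowers g) {M : Type*} [AddCommMonoid M] (f : G → M) :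
    ∑ x, f x = ∑ j ∈ Finset.range (orderOf g), f (g ^ j) := by
  classical
  rw [orderOf_eq_card_of_forall_mem_zpowers hg, ← IsCyclic.image_range_card hg,
    Finset.sum_image]
  intro i hi j hj h
  refine pow_injOn_Iio_orderOf ?_ ?_ h
  · simpa [orderOf_eq_card_of_forall_mem_zpowers hg] using hi
  · simpa [orderOf_eq_card_of_forall_mem_zpowers hg] using hj

lemma exists_isPrimitive_gaussSum'_eq (F : Type*) [Field F] [Fintype F] (p : ℕ) [Fact p.Prime]
    [CharP F p] [Algebra (ZMod p) F] {ζ : ℂ} (hζ : IsPrimitiveRoot ζ p) :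
    ∃ ψ : AddChar F ℂ, ψ.IsPrimitive ∧ ∀ χ : MulChar F ℂ, gaussSum' p ζ χ = gaussSum χ ψ := by
  have : NeZero p := ⟨(Fact.out : p.Prime).ne_zero⟩
  refine ⟨(AddChar.zmodChar p hζ.pow_eq_one).compAddMonoidHom
    (Algebra.trace (ZMod p) F).toAddMonoidHom, AddChar.IsPrimitive.of_ne_one fun h ↦ ?_,
    fun χ ↦ ?_⟩
  · refine AddChar.zmodChar_primitive_of_primitive_root p hζ one_ne_zero ?_
    ext a
    obtain ⟨x, rfl⟩ := Algebra.trace_surjective (ZMod p) F a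
    simpa using DFunLike.congr_fun h x
  · simp [gaussSum', gaussSum, stdAddChar, AddChar.zmodChar_apply]

/-- Theorem 8.1: for `q ≡ 1 (mod d)`, `t = (q-1)/d`, `T` a generator of the character group of
`F_q^×`, and `λ ∈ F_q^×`, the number of points of the Dwork hypersurface in `ℙ^{d-1}(F_q)` is
`(q^{d-1}-1)/(q-1) + q^{d-2}·₍d-1₎F₍d-2₎(T^t,…,T^{(d-1)t}; ε,…,ε | 1/λ^d)
 + (1/q)·∑_{w∈W**} ∏ᵢ g(T^{wᵢt}) + (1/(q-1))·∑_{[w]} ∑_j (∏ᵢ g(T^{wᵢt+j})/g(T^{dj}))·T^{dj}(dλ)`,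
where tuples `w` are modelled as elements of `(ZMod d)^d` (so `0 ≤ wᵢ < d` automatically and
`∑ wᵢ ≡ 0 (mod d)` reads `∑ wᵢ = 0`), `W**` consists of those `w` with `∑ wᵢ = 0`, all `wᵢ ≠ 0`
and the `wᵢ` not all equal, and the class sum is over an arbitrary set `V` of representatives of
the equivalence classes (under adding a constant tuple) of tuples summing to `0`, other than the
class of `(0,…,0)` (the constant tuples). -/
theorem dwork_hypersurface_point_count
    (F : Type*) [Field F] [Fintype F] (p : ℕ) [Fact p.Prime] [CharP F p] [Algebra (ZMod p) F]
    (ζ : ℂ) (hζ : IsPrimitiveRoot ζ p)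
    (d : ℕ) (hd : 2 ≤ d) (q t : ℕ) (hq : q = Fintype.card F) (hqd : q % d = 1)
    (ht : t = (q - 1) / d)
    (T : MulChar F ℂ) (hT : ∀ χ : MulChar F ℂ, χ ∈ Subgroup.zpowers T)
    (lam : F) (hlam : lam ≠ 0)
    (V : Finset (Fin d → ZMod d))
    (hV : ∀ v ∈ V, (∑ i, v i = 0) ∧ ¬∃ c : ZMod d, ∀ i, v i = c)
    (hVrep : ∀ w : Fin d → ZMod d, (∑ i, w i = 0) → (¬∃ c : ZMod d, ∀ i, w i = c) →
      ∃! v, v ∈ V ∧ ∃ c : ZMod d, ∀ i, w i = v i + c) :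
    (dworkHypersurfaceCount F d lam : ℂ) =
      ((q : ℂ) ^ (d - 1) - 1) / ((q : ℂ) - 1) +
        (q : ℂ) ^ (d - 2) *
          greeneF (d - 2) (fun i : Fin (d - 2 + 1) => T ^ (((i : ℕ) + 1) * t))
            (fun _ => 1) ((lam ^ d)⁻¹) +
        (1 / (q : ℂ)) *
          ∑ᶠ w ∈ {w : Fin d → ZMod d |
              (∑ i, w i = 0) ∧ (∀ i, w i ≠ 0) ∧ ¬∃ c : ZMod d, ∀ i, w i = c},
            ∏ i : Fin d, gaussSum' p ζ (T ^ ((w i).val * t)) +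
        (1 / ((q : ℂ) - 1)) *
          ∑ w ∈ V, ∑ j ∈ Finset.range (q - 1),
            (∏ i : Fin d, gaussSum' p ζ (T ^ ((w i).val * t + j))) /
                gaussSum' p ζ (T ^ (d * j)) * (T ^ (d * j)) ((d : F) * lam) := by
  classical
  subst hq
  have hNe : NeZero d := ⟨by omega⟩
  have : Fintype (MulChar F ℂ) := Fintype.ofFinite _
  have : IsCyclic (MulChar F ℂ) := ⟨T, hT⟩
  obtain ⟨ψ, hψ, hg⟩ := exists_isPrimitive_gaussSum'_eq F p hζ
  have hT' : orderOf T = Fintype.card F - 1 := by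
    rw [orderOf_eq_card_of_forall_mem_zpowers hT,
      MulChar.card_eq_card_units_of_hasEnoughRootsOfUnity, Nat.card_eq_fintype_card,
      Fintype.card_units]
  have hdt : d * t = Fintype.card F - 1 := by
    rw [ht, Nat.mul_div_cancel' ((Nat.modEq_iff_dvd' Fintype.card_pos).mp ?_)]
    rw [Nat.ModEq, hqd, Nat.mod_eq_of_lt hd]
  have ht0 : t ≠ 0 := by
    rintro rfl
    have := Fintype.one_lt_card (α := F)
    omega
  have hη : orderOf (T ^ t) = d := by
    rw [orderOf_pow_of_dvd ht0 ⟨d, by rw [hT', ← hdt, mul_comm]⟩, hT', ← hdt,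
      Nat.mul_div_cancel _ (Nat.pos_of_ne_zero ht0)]
  have hdF : (d : F) ≠ 0 := by
    intro h
    have h1 := congrArg (Nat.cast (R := F)) hdt
    rw [Nat.cast_sub Fintype.card_pos, Nat.cast_mul, h, FiniteField.cast_card_eq_zero] at h1
    simp at h1
  have h0V : (0 : Fin d → ZMod d) ∉ V := fun h ↦ (hV 0 h).2 ⟨0, fun _ ↦ rfl⟩
  have hpow : ∀ n, T ^ (n * t) = (T ^ t) ^ n := fun n ↦ by rw [← pow_mul, mul_comm]
  have hpow_add : ∀ n j, T ^ (n * t + j) = T ^ j * (T ^ t) ^ n := fun n j ↦ by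
    rw [pow_add, hpow, mul_comm]
  have hpow_d : ∀ j, T ^ (d * j) = (T ^ j) ^ d := fun j ↦ by rw [← pow_mul, mul_comm]
  have hcount := dworkHypersurfaceCount_eq hψ hη hdF hlam (insert 0 V) (fun v hv ↦ by
    rcases Finset.mem_insert.mp hv with rfl | hv
    · simp
    · exact (hV v hv).1) (fun w hw ↦ by
    by_cases hc : ∃ c, ∀ i, w i = c
    · obtain ⟨c, hc⟩ := hc
      refine ⟨0, ⟨by simp, c, by simpa using hc⟩, ?_⟩
      rintro v ⟨hv, c', hc'⟩
      rcases Finset.mem_insert.mp hv with rfl | hv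
      · rfl
      · exact ((hV v hv).2 ⟨c - c', fun i ↦ by rw [← hc i, hc' i, add_sub_cancel_right]⟩).elim
    · obtain ⟨v, ⟨hv, hvc⟩, hu⟩ := hVrep w hw hc
      refine ⟨v, ⟨Finset.mem_insert_of_mem hv, hvc⟩, ?_⟩
      rintro v' ⟨hv', c', hc'⟩
      rcases Finset.mem_insert.mp hv' with rfl | hv'
      · exact (hc ⟨c', by simpa using hc'⟩).elim
      · exact hu v' ⟨hv', c', hc'⟩)
  have hF := card_pow_mul_greeneF hψ hη hd hdF hlam
  have hW := sum_zero_sum_filter_ne_zero fun w : Fin d → ZMod d ↦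
    ∏ i, gaussSum ((T ^ t) ^ (w i).val) ψ
  simp only [Finset.prod_const, Finset.card_univ, Fintype.card_fin] at hW
  rw [Finset.sum_insert h0V, hW] at hcount
  simp only [Pi.zero_apply, ZMod.val_zero, pow_zero, mul_one, Finset.prod_const, Finset.card_univ,
    Fintype.card_fin, IsCyclic.sum_eq_sum_range_orderOf hT, hT'] at hcount hF
  simp only [hg, hpow, hpow_add, hpow_d]
  rw [hF, hcount]
  simp only [div_mul_eq_mul_div, mul_comm (∏ i, gaussSum _ ψ)]
  ring
end

section
/- Let p be a prime with p ≡ 3 (mod 4), let θ be the standard nontrivial additive character of F_p, and let λ ∈ F_p. Then Σ_{z∈F_p^×} Σ' θ(z·(x₁⁴ + x₂⁴ + x₃⁴ + x₄⁴ − 4λ·x₁x₂x₃x₄)) = (p−1)(6p−1), where Σ' runs over all quadruples (x₁, x₂, x₃, x₄) ∈ F_p⁴ in which at least one coordinate xᵢ equals 0. -/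
/-- In odd characteristic, the sum of `f (x ^ 2)` weights each `t` by `χ t + 1`, the number of its
square roots, where `χ` is the quadratic character. -/
lemma sum_comp_sq {F R : Type*} [Field F] [Fintype F] [DecidableEq F] [CommRing R]
    (hF : ringChar F ≠ 2) (f : F → R) :
    ∑ x, f (x ^ 2) = ∑ t, ((quadraticChar F t : R) + 1) * f t := by
  rw [← Finset.sum_fiberwise Finset.univ (fun x : F => x ^ 2)]
  refine Finset.sum_congr rfl fun t _ => ?_
  have hcard := quadraticChar_card_sqrts hF t
  rw [Finset.sum_congr rfl (g := fun _ => f t)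
    (fun x hx => by rw [(Finset.mem_filter.mp hx).2]), Finset.sum_const, nsmul_eq_mul]
  congr 1
  rw [show ({x | x ^ 2 = t} : Set F).toFinset = Finset.univ.filter (fun x : F => x ^ 2 = t) by
    ext; simp] at hcard
  exact_mod_cast congrArg (Int.cast : ℤ → R) hcard

/-- If `-1` is not a square, then fourth powers are distributed like squares. -/
lemma sum_comp_pow_four {F R : Type*} [Field F] [Fintype F] [DecidableEq F] [CommRing R]
    [IsDomain R] [CharZero R] (hF : ringChar F ≠ 2) (hneg : quadraticChar F (-1) = -1)
    (f : F → R) :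
    ∑ x, f (x ^ 4) = ∑ t, ((quadraticChar F t : R) + 1) * f t := by
  have hodd : ∑ t, (quadraticChar F t : R) * f (t ^ 2) = 0 := by
    refine self_eq_neg.mp ?_
    conv_lhs => rw [← Equiv.sum_comp (Equiv.neg F)]
    rw [← Finset.sum_neg_distrib]
    refine Finset.sum_congr rfl fun t _ => ?_
    rw [Equiv.neg_apply, ← neg_one_mul t, map_mul, hneg, mul_pow]
    simp
  calc ∑ x, f (x ^ 4) = ∑ x, f ((x ^ 2) ^ 2) := by simp only [← pow_mul, Nat.reduceMul]
    _ = ∑ t, ((quadraticChar F t : R) + 1) * f (t ^ 2) := sum_comp_sq hF fun t => f (t ^ 2)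
    _ = ∑ t, f (t ^ 2) := by simp only [add_mul, one_mul, Finset.sum_add_distrib, hodd, zero_add]
    _ = _ := sum_comp_sq hF f

/-- The quartic exponential sum in terms of the quadratic Gauss sum. -/
lemma sum_addChar_mul_pow_four {F R : Type*} [Field F] [Fintype F] [DecidableEq F] [CommRing R]
    [IsDomain R] [CharZero R] (hF : ringChar F ≠ 2) (hneg : quadraticChar F (-1) = -1)
    {ψ : AddChar F R} (hψ : ψ.IsPrimitive) {z : F} (hz : z ≠ 0) :
    ∑ x, ψ (z * x ^ 4) =
      (quadraticChar F z : R) *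
        gaussSum ((quadraticChar F).ringHomComp (Int.castRingHom R)) ψ := by
  have hshift := gaussSum_mulShift ((quadraticChar F).ringHomComp (Int.castRingHom R)) ψ
    (Units.mk0 z hz)
  have hsq : (quadraticChar F z : R) * (quadraticChar F z : R) = 1 := by
    exact_mod_cast congrArg (Int.cast : ℤ → R) ((sq _).symm.trans (quadraticChar_sq_one hz))
  have hzero : ∑ t, ψ (z * t) = 0 := by
    simpa [hz, mul_comm] using AddChar.sum_mulShift z hψ
  rw [sum_comp_pow_four hF hneg fun t => ψ (z * t)]
  simp only [add_mul, one_mul, Finset.sum_add_distrib, hzero, add_zero]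
  rw [← hshift, ← mul_assoc, MulChar.ringHomComp_apply, Units.val_mk0, eq_intCast, hsq, one_mul]
  simp only [gaussSum, AddChar.mulShift_apply, MulChar.ringHomComp_apply, eq_intCast]

/-- The sum of a product `∏ i, f (x i)` over the tuples with a coordinate equal to `0`. -/
lemma sum_prod_filter_exists_eq_zero {F R : Type*} [Fintype F] [DecidableEq F] [Zero F]
    [CommRing R] (n : ℕ) (f : F → R) :
    ∑ x ∈ Finset.univ.filter (fun x : Fin n → F => ∃ i, x i = 0), ∏ i, f (x i) =
      (∑ a, f a) ^ n - (∑ a, f a - f 0) ^ n := by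
  have herase : ∑ a, f a - f 0 = ∑ a, if a = 0 then 0 else f a := by
    rw [sub_eq_iff_eq_add, ← Finset.add_sum_erase _ f (Finset.mem_univ 0), add_comm]
    simp [Finset.sum_ite, Finset.filter_ne']
  rw [herase, Fintype.sum_pow, Fintype.sum_pow, ← Finset.sum_sub_distrib, Finset.sum_filter]
  refine Finset.sum_congr rfl fun x _ => ?_
  split_ifs with h
  · obtain ⟨i, hi⟩ := h
    have hprod : ∏ j, (if x j = 0 then 0 else f (x j)) = 0 :=
      Finset.prod_eq_zero (Finset.mem_univ i) (if_pos hi)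
    rw [hprod, sub_zero]
  · push Not at h
    simp [h]

/-- For `p ≡ 3 (mod 4)` and `θ(x) = ζ_p^x` the standard additive character of `F_p`, the sum
`∑_{z∈F_p^×} ∑' θ(z·(x₁⁴+x₂⁴+x₃⁴+x₄⁴-4λx₁x₂x₃x₄))`, where `∑'` runs over the quadruples with
at least one coordinate equal to `0`, equals `(p-1)(6p-1)`. -/
theorem boundary_sum_eq
    (p : ℕ) [Fact p.Prime] (hp : p % 4 = 3) (ζ : ℂ) (hζ : IsPrimitiveRoot ζ p)
    (lam : ZMod p) :
    ∑ z ∈ Finset.univ \ {(0 : ZMod p)},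
        ∑ x ∈ Finset.univ.filter (fun x : Fin 4 → ZMod p => ∃ i, x i = 0),
          ζ ^ (z * (x 0 ^ 4 + x 1 ^ 4 + x 2 ^ 4 + x 3 ^ 4 -
                4 * lam * (x 0 * x 1 * x 2 * x 3))).val =
      ((p : ℂ) - 1) * (6 * (p : ℂ) - 1) := by
  have hF : ringChar (ZMod p) ≠ 2 := by
    rw [ZMod.ringChar_zmod_n]
    rintro rfl
    omega
  have hneg : quadraticChar (ZMod p) (-1) = -1 := by
    rw [quadraticChar_neg_one hF, ZMod.card, ZMod.χ₄_nat_three_mod_four hp]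
  set ψ : AddChar (ZMod p) ℂ := AddChar.zmodChar p hζ.pow_eq_one with hψ_def
  have hψ : ψ.IsPrimitive := AddChar.zmodChar_primitive_of_primitive_root p hζ
  set χ := (quadraticChar (ZMod p)).ringHomComp (Int.castRingHom ℂ) with hχ_def
  set g : ℂ := gaussSum χ ψ
  have hχ : χ ≠ 1 :=
    (MulChar.ringHomComp_ne_one_iff (RingHom.injective_int _)).mpr (quadraticChar_ne_one hF)
  have hg : g ^ 2 = -(p : ℂ) := by
    rw [gaussSum_sq hχ ((quadraticChar_isQuadratic _).comp _) hψ]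
    simp [hχ_def, hneg, ZMod.card]
  have hinner : ∀ z ∈ Finset.univ \ {(0 : ZMod p)},
      ∑ x ∈ Finset.univ.filter (fun x : Fin 4 → ZMod p => ∃ i, x i = 0),
          ζ ^ (z * (x 0 ^ 4 + x 1 ^ 4 + x 2 ^ 4 + x 3 ^ 4 -
                4 * lam * (x 0 * x 1 * x 2 * x 3))).val =
        (4 * g - 4 * p * g) * χ z + (6 * p - 1) := by
    intro z hz
    have hz0 : z ≠ 0 := by simpa using hz
    have hsq : χ z ^ 2 = 1 := by
      simpa [hχ_def] using congrArg (Int.cast : ℤ → ℂ) (quadraticChar_sq_one hz0)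
    have hS : ∑ x, ψ (z * x ^ 4) = χ z * g := by
      exact sum_addChar_mul_pow_four hF hneg hψ hz0
    trans ∑ x ∈ Finset.univ.filter (fun x : Fin 4 → ZMod p => ∃ i, x i = 0),
        ∏ i, ψ (z * x i ^ 4)
    · refine Finset.sum_congr rfl fun x hx => ?_
      obtain ⟨i, hi⟩ := (Finset.mem_filter.mp hx).2
      have hprod : x 0 * x 1 * x 2 * x 3 = 0 := by
        rw [← Fin.prod_univ_four]
        exact Finset.prod_eq_zero (Finset.mem_univ i) hi
      rw [hprod, mul_zero, sub_zero, ← AddChar.zmodChar_apply hζ.pow_eq_one, ← hψ_def,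
        Fin.prod_univ_four]
      simp only [mul_add, AddChar.map_add_eq_mul]
    · rw [sum_prod_filter_exists_eq_zero 4 fun a => ψ (z * a ^ 4), hS]
      simp only [ne_eq, OfNat.ofNat_ne_zero, not_false_eq_true, zero_pow, mul_zero,
        AddChar.map_zero_eq_one]
      linear_combination (4 * χ z * g ^ 3 - 6 * g ^ 2) * hsq + (4 * χ z * g - 6) * hg
  have hχsum : ∑ z ∈ Finset.univ \ {(0 : ZMod p)}, χ z = 0 := by
    rw [Finset.sum_sdiff_eq_sub (Finset.subset_univ _), MulChar.sum_eq_zero_of_ne_one hχ,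
      Finset.sum_singleton, MulChar.map_zero, sub_zero]
  have hcard : ((Finset.univ \ {(0 : ZMod p)}).card : ℂ) = p - 1 := by
    rw [Finset.card_sdiff_of_subset (Finset.subset_univ _), Finset.card_univ, ZMod.card,
      Finset.card_singleton, Nat.cast_sub (Fact.out : p.Prime).one_le, Nat.cast_one]
  rw [Finset.sum_congr rfl hinner, Finset.sum_add_distrib, ← Finset.mul_sum, hχsum, mul_zero,
    zero_add, Finset.sum_const, nsmul_eq_mul, hcard]
end
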